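/- arXiv:1412.5641 — 2 statements merged into one kernel-verified Lean document; each statement's English description precedes it below -/
import Mathlib

section
/- Let 1 ≤ p < ∞ and let 1 ≤ q ≤ p*_α with q < ∞, where p*_α = p(n+α)/(n+α−p) if p < n+α and p*_α = ∞ otherwise. Then the embedding W^{1,p}(D_ε; ω^ε) ↪ L^q(D_ε; ω^ε) is continuous, and there exists a constant C independent of ε ∈ (0, ε₀) such that ‖u‖_{L^q(D_ε;ω^ε)} ≤ C ‖u‖_{W^{1,p}(D_ε;ω^ε)} for every u ∈ W^{1,p}(D_ε;ω^ε). -/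
open MeasureTheory ENNReal Set Filter Topology
open scoped RealInnerProductSpace

noncomputable section

/-- The weighted measure `w dx` restricted to the set `U`. -/
def wMeas {n : ℕ} (U : Set (EuclideanSpace ℝ (Fin n)))
    (w : EuclideanSpace ℝ (Fin n) → ℝ) : Measure (EuclideanSpace ℝ (Fin n)) :=
  (volume.restrict U).withDensity fun x => ENNReal.ofReal (w x)

/-- Product rule in integrated form for a differentiable function with integrable derivative times
a Lipschitz weight vanishing at the right end point. -/
theorem ofReal_abs_mul_le_lintegral_Icc {g ω Ω : ℝ → ℝ} {a b : ℝ} (hab : a ≤ b)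
    (hg : ∀ t ∈ Icc a b, DifferentiableAt ℝ g t)
    (hint : IntervalIntegrable (deriv g) volume a b)
    {K : NNReal} (hω : LipschitzOnWith K ω (Icc a b)) (hb : ω b = 0)
    (hΩ : ∀ t ∈ Icc a b, DifferentiableAt ℝ ω t → |deriv ω t| ≤ Ω t) :
    ENNReal.ofReal (|g a * ω a|) ≤
      ∫⁻ t in Icc a b, ENNReal.ofReal (|deriv g t| * |ω t| + |g t| * Ω t) := by
  set G : ℝ → ℝ := fun x => g a + ∫ v in a..x, deriv g v
  have hGg : ∀ t ∈ Icc a b, G t = g t := by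
    intro t ht
    have hsub : uIcc a t ⊆ Icc a b := by
      rw [uIcc_of_le ht.1]; exact Icc_subset_Icc_right ht.2
    have := intervalIntegral.integral_eq_sub_of_hasDerivAt (a := a) (b := t) (f := g)
      (f' := deriv g) (fun x hx => (hg x (hsub hx)).hasDerivAt)
      (hint.mono_set (by rw [uIcc_of_le hab]; exact hsub))
    simp only [G, this]; ring
  have hGac : AbsolutelyContinuousOnInterval G a b := by
    have h1 : AbsolutelyContinuousOnInterval (fun _ : ℝ => g a) a b :=
      (LipschitzWith.const (g a)).lipschitzOnWith.absolutelyContinuousOnInterval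
    exact h1.fun_add (hint.absolutelyContinuousOnInterval_intervalIntegral left_mem_uIcc)
  have hωac : AbsolutelyContinuousOnInterval ω a b :=
    LipschitzOnWith.absolutelyContinuousOnInterval (by rwa [uIcc_of_le hab])
  have key := hGac.integral_deriv_mul_eq_sub hωac
  rw [hb, mul_zero, zero_sub, hGg a (left_mem_Icc.2 hab), intervalIntegral.integral_of_le hab]
    at key
  have hae := hωac.ae_differentiableAt
  calc ENNReal.ofReal (|g a * ω a|)
      = ‖∫ x in Ioc a b, deriv G x * ω x + G x * deriv ω x‖ₑ := by
        rw [key, enorm_neg, Real.enorm_eq_ofReal_abs]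
    _ ≤ ∫⁻ x in Ioc a b, ‖deriv G x * ω x + G x * deriv ω x‖ₑ :=
        enorm_integral_le_lintegral_enorm _
    _ = ∫⁻ x in Ioo a b, ‖deriv G x * ω x + G x * deriv ω x‖ₑ := by
        rw [restrict_Ioo_eq_restrict_Ioc]
    _ ≤ ∫⁻ t in Ioo a b, ENNReal.ofReal (|deriv g t| * |ω t| + |g t| * Ω t) := by
        refine setLIntegral_mono_ae' measurableSet_Ioo ?_
        filter_upwards [hae] with t ht htab
        have htI : t ∈ Icc a b := Ioo_subset_Icc_self htab
        have hd := ht (by rwa [uIcc_of_le hab])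
        have hG' : deriv G t = deriv g t := by
          apply Filter.EventuallyEq.deriv_eq
          filter_upwards [Icc_mem_nhds htab.1 htab.2] with s hs using hGg s hs
        rw [Real.enorm_eq_ofReal_abs, hG', hGg t htI]
        apply ENNReal.ofReal_le_ofReal
        calc |deriv g t * ω t + g t * deriv ω t| ≤ |deriv g t * ω t| + |g t * deriv ω t| :=
              abs_add_le _ _
          _ = |deriv g t| * |ω t| + |g t| * |deriv ω t| := by rw [abs_mul, abs_mul]
          _ ≤ _ := by gcongr; exact hΩ t htI hd
    _ ≤ _ := lintegral_mono_set Ioo_subset_Icc_self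

/-- If a weight `Ψ` runs down to a nonpositive value along `[a, b]`, then `Ψ a * |g a|` is bounded
by the total variation of `Ψ * g`, in terms of a bound `Ω` for the derivative of `Ψ`. -/
theorem ofReal_mul_abs_le_lintegral {g Ψ Ω : ℝ → ℝ} {a b : ℝ} (hab : a ≤ b) {P : Set ℝ}
    (hΨc : ContinuousOn Ψ (Icc a b)) (hΨb : Ψ b ≤ 0)
    (hP : ∀ s ∈ Icc a b, 0 < Ψ s → s ∈ P)
    (hg : ∀ s ∈ Icc a b, 0 < Ψ s → DifferentiableAt ℝ g s)
    (hLip : ∀ κ > 0, ∃ K : NNReal, LipschitzOnWith K Ψ {s ∈ Icc a b | κ ≤ Ψ s})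
    (hΩ0 : ∀ s, 0 ≤ Ω s)
    (hΩ : ∀ s ∈ Icc a b, 0 < Ψ s → DifferentiableAt ℝ Ψ s → |deriv Ψ s| ≤ Ω s) :
    ENNReal.ofReal (Ψ a * |g a|) ≤
      ∫⁻ s in P, ENNReal.ofReal (|deriv g s| * Ψ s + |g s| * Ω s) := by
  have main : ∀ κ, 0 < κ → κ < Ψ a → ENNReal.ofReal ((Ψ a - κ) * |g a|) ≤
      ∫⁻ s in P, ENNReal.ofReal (|deriv g s| * Ψ s + |g s| * Ω s) := by
    intro κ hκ hκa
    set Z := Icc a b ∩ Ψ ⁻¹' {κ}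
    have hZc : IsCompact Z :=
      isCompact_Icc.of_isClosed_subset
        (hΨc.preimage_isClosed_of_isClosed isClosed_Icc isClosed_singleton) inter_subset_left
    have hZn : Z.Nonempty := by
      obtain ⟨s, hs, hs'⟩ := intermediate_value_Icc' hab hΨc (show κ ∈ Icc (Ψ b) (Ψ a) from
        ⟨by linarith, hκa.le⟩)
      exact ⟨s, hs, hs'⟩
    obtain ⟨c, ⟨hc, hcκ⟩, hcmin⟩ := hZc.exists_isLeast hZn
    have hcκ' : Ψ c = κ := hcκ
    have hsub : Icc a c ⊆ Icc a b := Icc_subset_Icc_right hc.2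
    have hge : ∀ s ∈ Icc a c, κ ≤ Ψ s := by
      intro s hs
      by_contra! hlt
      obtain ⟨z, hz, hz'⟩ := intermediate_value_Icc' hs.1
        (hΨc.mono (Icc_subset_Icc_right (hs.2.trans hc.2)))
        (show κ ∈ Icc (Ψ s) (Ψ a) from ⟨hlt.le, hκa.le⟩)
      have h1 : c ≤ z := hcmin ⟨⟨hz.1, hz.2.trans (hs.2.trans hc.2)⟩, hz'⟩
      have h2 : s = c := le_antisymm hs.2 (h1.trans hz.2)
      rw [h2] at hlt
      linarith
    have hIP : Icc a c ⊆ P := fun s hs => hP s (hsub hs) (hκ.trans_le (hge s hs))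
    refine le_trans ?_ (lintegral_mono_set hIP)
    by_cases hint : IntervalIntegrable (deriv g) volume a c
    · obtain ⟨K, hK⟩ := hLip κ hκ
      have hK' : LipschitzOnWith K (fun s => Ψ s - κ) (Icc a c) := by
        intro x hx y hy
        have := hK (x := x) ⟨hsub hx, hge x hx⟩ (y := y) ⟨hsub hy, hge y hy⟩
        simpa [edist_sub_right] using this
      have := ofReal_abs_mul_le_lintegral_Icc (g := g) (Ω := Ω) hc.1
        (fun t ht => hg t (hsub ht) (hκ.trans_le (hge t ht))) hint hK' (by simp [hcκ'])
        (fun t ht hd => by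
          rw [deriv_sub_const]
          have hd' : DifferentiableAt ℝ Ψ t := by
            have := hd.add_const κ
            simpa using this
          exact hΩ t (hsub ht) (hκ.trans_le (hge t ht)) hd')
      rw [abs_mul, abs_of_pos (sub_pos.2 hκa), mul_comm] at this
      refine this.trans (setLIntegral_mono' measurableSet_Icc fun t ht => ?_)
      apply ENNReal.ofReal_le_ofReal
      have h1 := hge t ht
      rw [abs_of_nonneg (by linarith : 0 ≤ Ψ t - κ)]
      have : |deriv g t| * (Ψ t - κ) ≤ |deriv g t| * Ψ t := by gcongr; linarith
      linarith
    · have htop : ∫⁻ t in Icc a c, ENNReal.ofReal (κ * |deriv g t|) = ∞ := by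
        by_contra hne
        apply hint
        rw [intervalIntegrable_iff_integrableOn_Icc_of_le hc.1]
        have hm : Measurable (deriv g) := measurable_deriv g
        refine ⟨hm.aestronglyMeasurable, ?_⟩
        have : ∫⁻ t in Icc a c, ENNReal.ofReal (κ * |deriv g t|)
            = ENNReal.ofReal κ * ∫⁻ t in Icc a c, ‖deriv g t‖ₑ := by
          rw [← lintegral_const_mul _ hm.enorm]
          simp_rw [Real.enorm_eq_ofReal_abs, ENNReal.ofReal_mul hκ.le]
        rw [this] at hne
        rw [HasFiniteIntegral, lt_top_iff_ne_top]
        intro h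
        apply hne
        rw [h, ENNReal.mul_top (by simpa using hκ)]
      have : ∫⁻ s in Icc a c, ENNReal.ofReal (|deriv g s| * Ψ s + |g s| * Ω s) = ∞ := by
        rw [eq_top_iff, ← htop]
        refine setLIntegral_mono' measurableSet_Icc fun t ht => ENNReal.ofReal_le_ofReal ?_
        have h1 : κ * |deriv g t| ≤ |deriv g t| * Ψ t := by
          rw [mul_comm]; gcongr; exact hge t ht
        have h2 := mul_nonneg (abs_nonneg (g t)) (hΩ0 t)
        linarith
      rw [this]; exact le_top
  rcases le_or_gt (Ψ a) 0 with h0 | h0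
  · rw [ENNReal.ofReal_of_nonpos (mul_nonpos_of_nonpos_of_nonneg h0 (abs_nonneg _))]
    exact zero_le
  · have hlim : Tendsto (fun κ => ENNReal.ofReal ((Ψ a - κ) * |g a|)) (𝓝[>] 0)
        (𝓝 (ENNReal.ofReal ((Ψ a - 0) * |g a|))) := by
      apply Tendsto.mono_left _ nhdsWithin_le_nhds
      exact (ENNReal.continuous_ofReal.comp (by fun_prop)).tendsto 0
    rw [sub_zero] at hlim
    refine le_of_tendsto hlim ?_
    filter_upwards [Ioo_mem_nhdsGT h0] with κ hκ using main κ hκ.1 hκ.2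

/-- Change of variables inequality for a map of the line expanding distances by a factor `c`. -/
theorem setLIntegral_comp_le_of_expanding {D : ℝ → ℝ} (hD : Measurable D) {A B : Set ℝ}
    {c : ℝ} (hc : 0 < c)
    (hexp : ∀ s ∈ A, ∀ t ∈ A, c * |s - t| ≤ |D s - D t|) (hAB : MapsTo D A B)
    {k : ℝ → ℝ≥0∞} (hk : Measurable k) :
    ∫⁻ t in A, k (D t) ≤ ENNReal.ofReal (1 / c) * ∫⁻ τ in B, k τ := by
  have hle : (volume.restrict A).map D ≤ (ENNReal.ofReal (1 / c)) • volume.restrict B := by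
    refine Measure.le_iff.2 fun E hE => ?_
    rw [Measure.map_apply hD hE, Measure.restrict_apply (hD hE), Measure.smul_apply,
      Measure.restrict_apply hE, smul_eq_mul]
    set A' := D ⁻¹' E ∩ A
    have hinj : InjOn D A' := by
      intro s hs t ht hst
      have := hexp s hs.2 t ht.2
      rw [hst, sub_self, abs_zero] at this
      have h2 : |s - t| ≤ 0 := by
        by_contra! h
        have := mul_pos hc h
        linarith
      exact sub_eq_zero.1 (abs_nonpos_iff.1 h2)
    set ψ := Function.invFunOn D A'
    have himg : A' = ψ '' (D '' A') := (hinj.invFunOn_image Subset.rfl).symm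
    have hlip : LipschitzOnWith (Real.toNNReal (1 / c)) ψ (D '' A') := by
      apply LipschitzOnWith.of_dist_le_mul
      rintro _ ⟨s, hs, rfl⟩ _ ⟨t, ht, rfl⟩
      have h1 : ψ (D s) = s := hinj.leftInvOn_invFunOn hs
      have h2 : ψ (D t) = t := hinj.leftInvOn_invFunOn ht
      rw [h1, h2, Real.dist_eq, Real.dist_eq, Real.coe_toNNReal _ (by positivity)]
      have := hexp s hs.2 t ht.2
      rw [div_mul_eq_mul_div, one_mul, le_div_iff₀ hc]
      linarith
    have := hlip.hausdorffMeasure_image_le (d := 1) zero_le_one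
    rw [hausdorffMeasure_real, ← himg, ENNReal.rpow_one] at this
    refine this.trans ?_
    gcongr
    · exact le_rfl
    · rintro _ ⟨s, hs, rfl⟩
      exact ⟨hs.1, hAB hs.2⟩
  calc ∫⁻ t in A, k (D t) = ∫⁻ τ, k τ ∂((volume.restrict A).map D) :=
        (lintegral_map hk hD).symm
    _ ≤ ∫⁻ τ, k τ ∂((ENNReal.ofReal (1 / c)) • volume.restrict B) := lintegral_mono' hle le_rfl
    _ = _ := by rw [lintegral_smul_measure, smul_eq_mul]

/-- The mass of the derivative of the model weight `(1 - τ / ε) ^ α` on `[m, ε)`. -/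
theorem lintegral_model_weight {α ε m : ℝ} (hα : 0 < α) (hε : 0 < ε) (hm : m ≤ ε) :
    ∫⁻ τ in Ico m ε, ENNReal.ofReal (α / ε * (1 - τ / ε) ^ (α - 1)) =
      ENNReal.ofReal ((1 - m / ε) ^ α) := by
  have hI : IntervalIntegrable (fun x : ℝ => x ^ (α - 1)) volume 0 (1 - m / ε) :=
    intervalIntegral.intervalIntegrable_rpow' (by linarith)
  have hI2 : IntervalIntegrable (fun τ => α / ε * (1 - τ / ε) ^ (α - 1)) volume m ε := by
    apply IntervalIntegrable.const_mul
    have h1 := (hI.comp_sub_left 1).comp_mul_left (c := 1 / ε)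
    have h2 : ε⁻¹ * m * ε = m := by field_simp
    simpa [hε.ne', mul_comm ε, div_eq_inv_mul, mul_inv_cancel_left₀, h2] using h1.symm
  have hnn : ∀ τ ∈ Ico m ε, 0 ≤ α / ε * (1 - τ / ε) ^ (α - 1) := by
    intro τ hτ
    have : 0 ≤ 1 - τ / ε := by
      rw [sub_nonneg, div_le_one hε]; exact hτ.2.le
    positivity
  have hval : ∫ τ in m..ε, α / ε * (1 - τ / ε) ^ (α - 1) = (1 - m / ε) ^ α := by
    rw [intervalIntegral.integral_const_mul,
      intervalIntegral.integral_comp_sub_div (fun x => x ^ (α - 1)) hε.ne' 1,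
      div_self hε.ne', sub_self, integral_rpow (Or.inl (by linarith)), sub_add_cancel,
      Real.zero_rpow hα.ne', sub_zero, smul_eq_mul]
    field_simp
  rw [restrict_Ico_eq_restrict_Ioc, ← hval, intervalIntegral.integral_of_le hm,
    ofReal_integral_eq_lintegral_ofReal ((intervalIntegrable_iff_integrableOn_Ioc_of_le hm).1 hI2)]
  rw [← restrict_Ico_eq_restrict_Ioc]
  exact (ae_restrict_iff' measurableSet_Ico).2 (ae_of_all _ hnn)

/-- An integral inequality along all lines in a fixed direction integrates to the whole space. -/
theorem lintegral_le_of_forall_line {E : Type*} [NormedAddCommGroup E] [InnerProductSpace ℝ E]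
    [FiniteDimensional ℝ E] [MeasurableSpace E] [BorelSpace E] {e : E} (he : ‖e‖ = 1)
    {f g : E → ℝ≥0∞} (hf : Measurable f) (hg : Measurable g)
    (h : ∀ x, ∫⁻ t : ℝ, f (x + t • e) ≤ ∫⁻ t : ℝ, g (x + t • e)) :
    ∫⁻ x, f x ≤ ∫⁻ x, g x := by
  set S : Set E := {x | inner ℝ e x ∈ Icc (0 : ℝ) 1}
  have hS : MeasurableSet S :=
    measurableSet_Icc.preimage (by fun_prop : Measurable fun x : E => inner ℝ e x)
  have main : ∀ f : E → ℝ≥0∞, Measurable f →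
      ∫⁻ x in S, ∫⁻ t : ℝ, f (x + t • e) = ∫⁻ x, f x := by
    intro f hf
    have hline : Measurable fun p : E × ℝ => p.1 + p.2 • e := by fun_prop
    have hline' : Measurable fun p : E × ℝ => p.1 - p.2 • e := by fun_prop
    rw [lintegral_lintegral_swap (f := fun x t => f (x + t • e)) (hf.comp hline).aemeasurable]
    have h1 : ∀ t : ℝ, ∫⁻ x in S, f (x + t • e) = ∫⁻ y, S.indicator 1 (y - t • e) * f y := by
      intro t
      rw [← lintegral_add_right_eq_self (fun y => S.indicator 1 (y - t • e) * f y) (t • e),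
        ← lintegral_indicator hS]
      congr with x
      by_cases hx : x ∈ S <;> simp [hx]
    simp_rw [h1]
    rw [lintegral_lintegral_swap]
    · congr with y
      have hmeas : Measurable fun t : ℝ => S.indicator (1 : E → ℝ≥0∞) (y - t • e) :=
        (measurable_one.indicator hS).comp (by fun_prop : Measurable fun t : ℝ => y - t • e)
      rw [lintegral_mul_const _ hmeas]
      have h2 : ∀ t : ℝ, S.indicator (1 : E → ℝ≥0∞) (y - t • e)
          = (Icc (inner ℝ e y - 1) (inner ℝ e y)).indicator 1 t := by
        intro t
        have : y - t • e ∈ S ↔ t ∈ Icc (inner ℝ e y - 1) (inner ℝ e y) := by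
          simp only [S, mem_ofPred_eq, mem_Icc, inner_sub_right, inner_smul_right,
            real_inner_self_eq_norm_sq, he]
          constructor <;> rintro ⟨h1, h2⟩ <;> constructor <;> linarith
        by_cases ht : y - t • e ∈ S
        · simp [ht, this.1 ht]
        · rw [indicator_of_notMem ht, indicator_of_notMem (fun h => ht (this.2 h))]
      simp_rw [h2]
      rw [lintegral_indicator_one measurableSet_Icc, Real.volume_Icc]
      simp
    · apply Measurable.aemeasurable
      apply Measurable.mul
      · exact (measurable_one.indicator hS).comp
          (hline'.comp measurable_swap)
      · exact hf.comp measurable_snd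
  rw [← main f hf, ← main g hg]
  exact lintegral_mono fun x => h x

/-- The truncated, rescaled distance to the outer boundary of `{d < ε}`. -/
def truncDist {E : Type*} (d : E → ℝ) (ε : ℝ) (x : E) : ℝ := max 0 (min 1 (1 - d x / ε))

/-- Pointwise bound for the derivative of `truncDist d ε ^ α`. -/
def slopeWeight {E : Type*} (d : E → ℝ) (α ε : ℝ) (x : E) : ℝ :=
  if 0 ≤ d x then α / ε * truncDist d ε x ^ (α - 1) else 0

section Weights

variable {E : Type*} {d : E → ℝ} {α ε : ℝ} {x : E}

theorem truncDist_nonneg : 0 ≤ truncDist d ε x := le_max_left _ _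

theorem truncDist_le_one : truncDist d ε x ≤ 1 := max_le zero_le_one (min_le_left _ _)

theorem truncDist_pos_iff (hε : 0 < ε) : 0 < truncDist d ε x ↔ d x < ε := by
  simp [truncDist, div_lt_one hε]

theorem truncDist_of_nonneg (hε : 0 < ε) (h0 : 0 ≤ d x) (h : d x ≤ ε) :
    truncDist d ε x = 1 - d x / ε := by
  have h1 : d x / ε ≤ 1 := (div_le_one hε).2 h
  have h2 : 0 ≤ d x / ε := by positivity
  rw [truncDist, min_eq_right (by linarith), max_eq_right (by linarith)]

theorem truncDist_of_nonpos (hε : 0 < ε) (h0 : d x ≤ 0) : truncDist d ε x = 1 := by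
  have h2 : d x / ε ≤ 0 := div_nonpos_of_nonpos_of_nonneg h0 hε.le
  rw [truncDist, min_eq_left (by linarith), max_eq_right zero_le_one]

theorem slopeWeight_nonneg (hε : 0 < ε) (hα : 0 < α) : 0 ≤ slopeWeight d α ε x := by
  have := truncDist_nonneg (d := d) (ε := ε) (x := x)
  unfold slopeWeight
  split_ifs <;> positivity

theorem slopeWeight_add_ge {ε₀ : ℝ} (hε : 0 < ε) (hε₀ : ε ≤ ε₀) (hα : 0 < α) :
    min 1 (α / ε₀) * truncDist d ε x ^ (α - 1) ≤
      slopeWeight d α ε x + truncDist d ε x ^ α := by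
  have h0 := truncDist_nonneg (d := d) (ε := ε) (x := x)
  have hp := Real.rpow_nonneg h0 (α - 1)
  have hq := Real.rpow_nonneg h0 α
  by_cases h : 0 ≤ d x
  · have h1 : α / ε₀ ≤ α / ε := by gcongr
    rw [slopeWeight, if_pos h]
    have := mul_le_mul_of_nonneg_right ((min_le_right 1 (α / ε₀)).trans h1) hp
    linarith
  · rw [truncDist_of_nonpos hε (not_le.1 h).le, Real.one_rpow, Real.one_rpow]
    have := slopeWeight_nonneg (d := d) (x := x) hε hα
    have := min_le_left 1 (α / ε₀)
    linarith

theorem lipschitzWith_truncDist [PseudoMetricSpace E] (hd : LipschitzWith 1 d) (hε : 0 < ε) :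
    LipschitzWith (Real.toNNReal (1 / ε)) (truncDist d ε) := by
  have h1 : LipschitzWith (Real.toNNReal (1 / ε)) fun x => 1 - d x / ε := by
    apply LipschitzWith.of_dist_le_mul
    intro x y
    have := hd.dist_le_mul x y
    rw [NNReal.coe_one, one_mul] at this
    rw [dist_sub_left, Real.coe_toNNReal _ (by positivity), Real.dist_eq, ← sub_div, abs_div,
      abs_of_pos hε, ← Real.dist_eq]
    rw [one_div_mul_eq_div]
    gcongr
  exact (h1.const_min 1).const_max 0

theorem measurable_truncDist [MeasurableSpace E] (hd : Measurable d) :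
    Measurable (truncDist d ε) := by
  unfold truncDist
  fun_prop

theorem measurable_slopeWeight [MeasurableSpace E] (hd : Measurable d) :
    Measurable (slopeWeight d α ε) := by
  have := measurable_truncDist (ε := ε) hd
  unfold slopeWeight
  exact Measurable.ite (measurableSet_le measurable_const hd) (by fun_prop) measurable_const

variable [NormedAddCommGroup E] [NormedSpace ℝ E]

theorem lipschitzWith_line (x : E) {e : E} (he : ‖e‖ = 1) :
    LipschitzWith 1 fun t : ℝ => x + t • e := by
  apply LipschitzWith.of_dist_le_mul
  intro s t
  rw [dist_add_left, dist_eq_norm, ← sub_smul, norm_smul, he, Real.dist_eq]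
  simp

theorem hasDerivAt_line (x e : E) (t : ℝ) : HasDerivAt (fun t : ℝ => x + t • e) e t := by
  simpa using ((hasDerivAt_id t).smul_const e).const_add x

theorem abs_deriv_comp_line_le {v : E → ℝ} {x e : E} (he : ‖e‖ = 1) {t : ℝ}
    (hv : DifferentiableAt ℝ v (x + t • e)) :
    |deriv (fun s : ℝ => v (x + s • e)) t| ≤ ‖fderiv ℝ v (x + t • e)‖ := by
  have h : HasDerivAt (fun s : ℝ => v (x + s • e)) (fderiv ℝ v (x + t • e) e) t :=
    hv.hasFDerivAt.comp_hasDerivAt t (hasDerivAt_line x e t)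
  rw [h.deriv]
  simpa [he] using (fderiv ℝ v (x + t • e)).le_opNorm e

theorem abs_deriv_weight_line_le (hd : LipschitzWith 1 d) (hε : 0 < ε) (hα : 0 < α) {e : E}
    (he : ‖e‖ = 1) {t : ℝ} (ht : 0 < truncDist d ε (x + t • e))
    (hdiff : DifferentiableAt ℝ (fun s : ℝ => truncDist d ε (x + s • e) ^ α) t) :
    |deriv (fun s : ℝ => truncDist d ε (x + s • e) ^ α) t| ≤ slopeWeight d α ε (x + t • e) := by
  set r : ℝ → ℝ := fun s => truncDist d ε (x + s • e)
  have hr : LipschitzWith (Real.toNNReal (1 / ε)) r := by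
    have := (lipschitzWith_truncDist hd hε).comp (lipschitzWith_line x he)
    rwa [mul_one] at this
  by_cases h : 0 ≤ d (x + t • e)
  · rw [slopeWeight, if_pos h]
    have hrd : DifferentiableAt ℝ r t := by
      have h1 : DifferentiableAt ℝ (fun s => (r s ^ α) ^ (α⁻¹)) t :=
        hdiff.rpow_const (Or.inl (Real.rpow_pos_of_pos ht α).ne')
      have h2 : (fun s => (r s ^ α) ^ (α⁻¹)) = r := by
        ext s
        exact Real.rpow_rpow_inv truncDist_nonneg hα.ne'
      rwa [h2] at h1
    have hb : |deriv r t| ≤ 1 / ε := by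
      have := norm_deriv_le_of_lipschitz (x₀ := t) hr
      rwa [Real.coe_toNNReal _ (by positivity), Real.norm_eq_abs] at this
    have h3 := (hrd.hasDerivAt.rpow_const (p := α) (Or.inl ht.ne')).deriv
    rw [h3, abs_mul, abs_mul, abs_of_pos hα, abs_of_nonneg (Real.rpow_nonneg truncDist_nonneg _)]
    calc |deriv r t| * α * r t ^ (α - 1) ≤ 1 / ε * α * r t ^ (α - 1) := by
          gcongr
      _ = _ := by simp only [r]; ring
  · rw [slopeWeight, if_neg h]
    have hcont : Continuous fun s : ℝ => d (x + s • e) :=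
      hd.continuous.comp (lipschitzWith_line x he).continuous
    have h1 : (fun s => r s ^ α) =ᶠ[𝓝 t] fun _ => 1 := by
      filter_upwards [hcont.continuousAt.eventually_lt_const (not_le.1 h)] with s hs
      simp only [r]
      rw [truncDist_of_nonpos hε hs.le, Real.one_rpow]
    rw [h1.deriv_eq]
    simp

theorem lipschitzOnWith_rpow_Icc (α : ℝ) {δ : ℝ} (hδ : 0 < δ) :
    ∃ K : NNReal, LipschitzOnWith K (fun x : ℝ => x ^ α) (Icc δ 1) := by
  have : ContDiffOn ℝ 1 (fun x : ℝ => x ^ α) (Icc δ 1) := fun y hy =>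
    (Real.contDiffAt_rpow_const_of_ne (hδ.trans_le hy.1).ne').contDiffWithinAt
  exact this.exists_lipschitzOnWith one_ne_zero (convex_Icc _ _) isCompact_Icc

/-- On each line the weighted function is bounded by the integral of its formal derivative. -/
theorem weight_mul_abs_le_lintegral_line
    (hd : LipschitzWith 1 d) (hε : 0 < ε) (hα : 0 < α)
    (hbdd : Bornology.IsBounded {y | d y < ε}) {v : E → ℝ}
    (hv : ∀ y, d y < ε → DifferentiableAt ℝ v y) {e : E} (he : ‖e‖ = 1) (x : E) :
    ENNReal.ofReal (truncDist d ε x ^ α * |v x|) ≤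
      ∫⁻ t in {t : ℝ | d (x + t • e) < ε}, ENNReal.ofReal
        (‖fderiv ℝ v (x + t • e)‖ * truncDist d ε (x + t • e) ^ α +
          |v (x + t • e)| * slopeWeight d α ε (x + t • e)) := by
  have hl := lipschitzWith_line x he
  have hcont : Continuous fun s : ℝ => d (x + s • e) := hd.continuous.comp hl.continuous
  have hρc : Continuous fun s : ℝ => truncDist d ε (x + s • e) :=
    (lipschitzWith_truncDist hd hε).continuous.comp hl.continuous
  obtain ⟨b, hb0, hb⟩ : ∃ b : ℝ, 0 ≤ b ∧ ¬ d (x + b • e) < ε := by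
    obtain ⟨R, hR⟩ := hbdd.subset_closedBall x
    refine ⟨|R| + 1, by positivity, fun h => ?_⟩
    have := hR h
    rw [Metric.mem_closedBall, dist_eq_norm, add_sub_cancel_left, norm_smul, he, mul_one,
      Real.norm_eq_abs, abs_of_nonneg (by positivity)] at this
    linarith [le_abs_self R]
  have hpos : ∀ s : ℝ, 0 < truncDist d ε (x + s • e) ^ α → 0 < truncDist d ε (x + s • e) := by
    intro s hs
    refine lt_of_le_of_ne truncDist_nonneg fun h => ?_
    rw [← h, Real.zero_rpow hα.ne'] at hs
    exact lt_irrefl _ hs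
  have hpos' : ∀ s : ℝ, 0 < truncDist d ε (x + s • e) ^ α → d (x + s • e) < ε := fun s hs =>
    (truncDist_pos_iff hε).1 (hpos s hs)
  have key := ofReal_mul_abs_le_lintegral (g := fun s : ℝ => v (x + s • e))
    (Ψ := fun s : ℝ => truncDist d ε (x + s • e) ^ α)
    (Ω := fun s : ℝ => slopeWeight d α ε (x + s • e)) (P := {t : ℝ | d (x + t • e) < ε}) hb0
    (hρc.rpow_const fun _ => Or.inr hα.le).continuousOn
    (by
      have : truncDist d ε (x + b • e) = 0 :=
        le_antisymm (not_lt.1 fun h => hb ((truncDist_pos_iff hε).1 h)) truncDist_nonneg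
      simp [this, Real.zero_rpow hα.ne'])
    (fun s _ hs => hpos' s hs)
    (fun s _ hs => (hv _ (hpos' s hs)).comp s (hasDerivAt_line x e s).differentiableAt)
    (fun κ hκ => by
      obtain ⟨K, hK⟩ := lipschitzOnWith_rpow_Icc α (δ := κ ^ α⁻¹) (by positivity)
      refine ⟨K * (Real.toNNReal (1 / ε) * 1), hK.comp
        ((lipschitzWith_truncDist hd hε).comp hl).lipschitzOnWith ?_⟩
      intro s hs
      refine ⟨?_, truncDist_le_one⟩
      have h1 : κ ^ α⁻¹ ≤ (truncDist d ε (x + s • e) ^ α) ^ α⁻¹ := by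
        gcongr; exact hs.2
      rwa [Real.rpow_rpow_inv truncDist_nonneg hα.ne'] at h1)
    (fun s => slopeWeight_nonneg hε hα)
    (fun s _ hs hdiff => abs_deriv_weight_line_le hd hε hα he (hpos s hs) hdiff)
  simp only [zero_smul, add_zero] at key
  refine key.trans (setLIntegral_mono' (measurableSet_lt hcont.measurable measurable_const) ?_)
  intro s hs
  apply ENNReal.ofReal_le_ofReal
  gcongr
  · exact Real.rpow_nonneg truncDist_nonneg _
  · exact abs_deriv_comp_line_le he (hv _ hs)

end Weights

section Hardy

variable {E : Type*} [NormedAddCommGroup E] {d : E → ℝ} {α ε : ℝ}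

/-- Hardy's inequality on a line along which `d` decreases at a definite rate. -/
theorem lintegral_slopeWeight_line_le [NormedSpace ℝ E] [MeasurableSpace E] [BorelSpace E]
    (hd : LipschitzWith 1 d) (hε : 0 < ε)
    (hα : 0 < α) {v : E → ℝ} (hvm : Measurable v)
    (hv : ∀ y, d y < ε → DifferentiableAt ℝ v y) {e : E} (he : ‖e‖ = 1) {x₀ : E} {r c : ℝ}
    (hr : 0 < r) (hc : 0 < c)
    (hmono : ∀ y ∈ Metric.ball x₀ r, ∀ t : ℝ, 0 ≤ t → y + t • e ∈ Metric.ball x₀ r →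
      d (y + t • e) ≤ d y - c * t) (x : E) :
    ∫⁻ t in {t : ℝ | x + t • e ∈ Metric.ball x₀ r ∧ d (x + t • e) < ε ∧ 0 ≤ d (x + t • e)},
        ENNReal.ofReal ((r - dist (x + t • e) x₀) * |v (x + t • e)| *
          slopeWeight d α ε (x + t • e)) ≤
      ENNReal.ofReal (1 / c) *
        ∫⁻ t in {t : ℝ | x + t • e ∈ Metric.ball x₀ r ∧ d (x + t • e) < ε},
          ENNReal.ofReal ((‖fderiv ℝ v (x + t • e)‖ * (r - dist (x + t • e) x₀) +
            |v (x + t • e)|) * truncDist d ε (x + t • e) ^ α) := by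
  have hl := lipschitzWith_line x he
  set l : ℝ → E := fun t => x + t • e
  have hlc : Continuous l := hl.continuous
  have hdm : Measurable fun t => d (l t) := (hd.continuous.comp hlc).measurable
  have hφm : Measurable fun t => r - dist (l t) x₀ := by
    have : Continuous fun t => r - dist (l t) x₀ := by fun_prop
    exact this.measurable
  have hvlm : Measurable fun t => |v (l t)| := (hvm.comp hlc.measurable).abs
  have hfm : Measurable fun t => ‖fderiv ℝ v (l t)‖ :=
    ((measurable_fderiv ℝ v).norm).comp hlc.measurable
  have hWm : Measurable fun t => truncDist d ε (l t) ^ α :=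
    ((measurable_truncDist hd.continuous.measurable).comp hlc.measurable).pow_const α
  have hHm : Measurable fun t => slopeWeight d α ε (l t) :=
    (measurable_slopeWeight hd.continuous.measurable).comp hlc.measurable
  set T : Set ℝ := {t | l t ∈ Metric.ball x₀ r ∧ d (l t) < ε}
  set T₀ : Set ℝ := {t | l t ∈ Metric.ball x₀ r ∧ d (l t) < ε ∧ 0 ≤ d (l t)}
  have hballm : MeasurableSet {t | l t ∈ Metric.ball x₀ r} :=
    (Metric.isOpen_ball.preimage hlc).measurableSet
  have hT : MeasurableSet T := hballm.inter (measurableSet_lt hdm measurable_const)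
  have hT₀ : MeasurableSet T₀ := hballm.inter ((measurableSet_lt hdm measurable_const).inter
    (measurableSet_le measurable_const hdm))
  have hstep : ∀ t s : ℝ, t ≤ s → l t ∈ Metric.ball x₀ r → l s ∈ Metric.ball x₀ r →
      d (l s) ≤ d (l t) - c * (s - t) := by
    intro t s hts ht hs
    have h1 : l s = l t + (s - t) • e := by simp only [l, sub_smul]; abel
    rw [h1] at hs ⊢
    exact hmono _ ht _ (sub_nonneg.2 hts) hs
  set k : ℝ → ℝ≥0∞ := fun s => ENNReal.ofReal (‖fderiv ℝ v (l s)‖ * (r - dist (l s) x₀) +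
    |v (l s)|)
  have hkm : Measurable k := ((hfm.mul hφm).add hvlm).ennreal_ofReal
  have hpoint : ∀ t ∈ T, ENNReal.ofReal ((r - dist (l t) x₀) * |v (l t)|) ≤
      ∫⁻ s in T ∩ Ici t, k s := by
    intro t ht
    have hmemT : ∀ s ∈ Icc t (t + 2 * r), 0 < r - dist (l s) x₀ → s ∈ T ∩ Ici t := by
      intro s hs hs'
      have hsb : l s ∈ Metric.ball x₀ r := by
        rw [Metric.mem_ball]; linarith
      refine ⟨⟨hsb, ?_⟩, hs.1⟩
      have h1 := hstep t s hs.1 ht.1 hsb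
      have h2 : 0 ≤ c * (s - t) := mul_nonneg hc.le (sub_nonneg.2 hs.1)
      have := ht.2
      linarith
    have hΨL : LipschitzWith 1 fun s => r - dist (l s) x₀ := by
      apply LipschitzWith.of_dist_le_mul
      intro s t
      rw [dist_sub_left, NNReal.coe_one, one_mul]
      exact (dist_dist_dist_le_left _ _ _).trans (by simpa using hl.dist_le_mul s t)
    refine (ofReal_mul_abs_le_lintegral (g := fun s => v (l s))
      (Ψ := fun s => r - dist (l s) x₀) (Ω := fun _ => 1) (P := T ∩ Ici t)
      (by linarith : t ≤ t + 2 * r) hΨL.continuous.continuousOn ?_ hmemT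
      (fun s hs hs' => (hv _ (hmemT s hs hs').1.2).comp s
        (hasDerivAt_line x e s).differentiableAt)
      (fun κ _ => ⟨1, hΨL.lipschitzOnWith⟩) (fun _ => zero_le_one)
      (fun s _ _ _ => by simpa using norm_deriv_le_of_lipschitz (x₀ := s) hΨL)).trans ?_
    · have h1 : dist (l (t + 2 * r)) (l t) = 2 * r := by
        simp only [l, dist_eq_norm]
        rw [add_sub_add_left_eq_sub, ← sub_smul, norm_smul, he, add_sub_cancel_left]
        simp [abs_of_pos hr]
      have h2 := dist_triangle_right (l (t + 2 * r)) (l t) x₀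
      have h3 : dist (l t) x₀ < r := ht.1
      linarith
    · refine setLIntegral_mono' (hT.inter measurableSet_Ici) fun s hs => ?_
      apply ENNReal.ofReal_le_ofReal
      have h1 : 0 ≤ r - dist (l s) x₀ := by
        have : dist (l s) x₀ < r := hs.1.1
        linarith
      rw [mul_one]
      gcongr
      exact abs_deriv_comp_line_le he (hv _ hs.1.2)
  have hinner : ∀ s ∈ T, ∫⁻ t in T₀ ∩ Iic s, ENNReal.ofReal (slopeWeight d α ε (l t)) ≤
      ENNReal.ofReal (1 / c) * ENNReal.ofReal (truncDist d ε (l s) ^ α) := by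
    intro s hs
    have hW : ENNReal.ofReal (truncDist d ε (l s) ^ α) =
        ∫⁻ τ in Ico (max 0 (d (l s))) ε, ENNReal.ofReal (α / ε * (1 - τ / ε) ^ (α - 1)) := by
      rw [lintegral_model_weight hα hε (max_le hε.le hs.2.le)]
      rcases le_total 0 (d (l s)) with h | h
      · rw [truncDist_of_nonneg hε h hs.2.le, max_eq_right h]
      · rw [truncDist_of_nonpos hε h, max_eq_left h]; simp
    rw [hW]
    refine le_trans (le_of_eq ?_) (setLIntegral_comp_le_of_expanding (D := fun t => d (l t))
      (A := T₀ ∩ Iic s) hdm hc ?_ ?_ ?_)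
    · refine setLIntegral_congr_fun (hT₀.inter measurableSet_Iic) fun t ht => ?_
      rw [slopeWeight, if_pos ht.1.2.2, truncDist_of_nonneg hε ht.1.2.2 ht.1.2.1.le]
    · have hwlog : ∀ a ∈ T₀ ∩ Iic s, ∀ b ∈ T₀ ∩ Iic s, a ≤ b →
          c * |a - b| ≤ |d (l a) - d (l b)| := by
        intro a ha b hb hab
        have h1 := hstep a b hab ha.1.1 hb.1.1
        rw [abs_sub_comm, abs_of_nonneg (sub_nonneg.2 hab)]
        exact le_trans (by linarith) (le_abs_self _)
      intro a ha b hb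
      rcases le_total a b with h | h
      · exact hwlog a ha b hb h
      · rw [abs_sub_comm a, abs_sub_comm (d (l a))]
        exact hwlog b hb a ha h
    · intro t ht
      have h1 := hstep t s ht.2 ht.1.1 hs.1
      have h2 : 0 ≤ c * (s - t) := mul_nonneg hc.le (sub_nonneg.2 ht.2)
      exact ⟨max_le ht.1.2.2 (by linarith), ht.1.2.1⟩
    · fun_prop
  have hjm : Measurable fun p : ℝ × ℝ => (T₀.indicator (fun t =>
      ENNReal.ofReal (slopeWeight d α ε (l t))) p.1) * ({p : ℝ × ℝ | p.1 ≤ p.2}.indicator 1 p *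
        T.indicator k p.2) :=
    ((hHm.ennreal_ofReal.indicator hT₀).comp measurable_fst).mul
      ((measurable_one.indicator (measurableSet_le measurable_fst measurable_snd)).mul
        ((hkm.indicator hT).comp measurable_snd))
  calc _ ≤ ∫⁻ t in T₀, ENNReal.ofReal (slopeWeight d α ε (l t)) * ∫⁻ s in T ∩ Ici t, k s := by
        refine setLIntegral_mono' hT₀ fun t ht => ?_
        have hnn : 0 ≤ (r - dist (l t) x₀) * |v (l t)| := by
          have : dist (l t) x₀ < r := ht.1
          have : 0 ≤ r - dist (l t) x₀ := by linarith
          positivity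
        rw [ENNReal.ofReal_mul hnn, mul_comm]
        gcongr
        exact hpoint t ⟨ht.1, ht.2.1⟩
    _ = ∫⁻ t, ∫⁻ s, (T₀.indicator (fun t => ENNReal.ofReal (slopeWeight d α ε (l t))) t) *
          ({p : ℝ × ℝ | p.1 ≤ p.2}.indicator 1 (t, s) * T.indicator k s) := by
        rw [← lintegral_indicator hT₀]
        congr with t
        rw [lintegral_const_mul _ (by
          exact (measurable_one.indicator (measurableSet_le measurable_fst measurable_snd)).comp
            measurable_prodMk_left |>.mul (hkm.indicator hT))]
        by_cases ht : t ∈ T₀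
        · rw [indicator_of_mem ht, indicator_of_mem ht, ← lintegral_indicator
            (hT.inter measurableSet_Ici)]
          congr 2 with s
          by_cases hs : s ∈ T <;> by_cases hts : t ≤ s <;> simp [hs, hts]
        · simp [ht]
    _ = ∫⁻ s, ∫⁻ t, (T₀.indicator (fun t => ENNReal.ofReal (slopeWeight d α ε (l t))) t) *
          ({p : ℝ × ℝ | p.1 ≤ p.2}.indicator 1 (t, s) * T.indicator k s) :=
        lintegral_lintegral_swap hjm.aemeasurable
    _ = ∫⁻ s in T, k s * ∫⁻ t in T₀ ∩ Iic s, ENNReal.ofReal (slopeWeight d α ε (l t)) := by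
        rw [← lintegral_indicator hT]
        congr with s
        by_cases hs : s ∈ T
        · simp only [indicator_of_mem hs]
          rw [← lintegral_indicator (hT₀.inter measurableSet_Iic),
            ← lintegral_const_mul _ (hHm.ennreal_ofReal.indicator (hT₀.inter measurableSet_Iic))]
          congr with t
          by_cases ht : t ∈ T₀ <;> by_cases hts : t ≤ s <;> simp [ht, hts, mul_comm]
        · simp [hs]
    _ ≤ ∫⁻ s in T, ENNReal.ofReal (1 / c) * ENNReal.ofReal ((‖fderiv ℝ v (l s)‖ *
          (r - dist (l s) x₀) + |v (l s)|) * truncDist d ε (l s) ^ α) := by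
        refine setLIntegral_mono' hT fun s hs => ?_
        rw [ENNReal.ofReal_mul' (Real.rpow_nonneg truncDist_nonneg _), mul_left_comm]
        gcongr
        exact hinner s hs
    _ = _ := lintegral_const_mul _
        (((hfm.mul hφm).add hvlm).mul hWm).ennreal_ofReal

/-- Local Hardy inequality near a point where `d` decreases uniformly in a fixed direction. -/
theorem lintegral_slopeWeight_halfBall_le [InnerProductSpace ℝ E] [FiniteDimensional ℝ E]
    [MeasurableSpace E] [BorelSpace E]
    (hd : LipschitzWith 1 d) (hα : 0 < α) {e : E} (he : ‖e‖ = 1) {x₀ : E} {r c : ℝ}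
    (hr : 0 < r) (hc : 0 < c)
    (hmono : ∀ y ∈ Metric.ball x₀ r, ∀ t : ℝ, 0 ≤ t → y + t • e ∈ Metric.ball x₀ r →
      d (y + t • e) ≤ d y - c * t)
    (hε : 0 < ε) {v : E → ℝ} (hvm : Measurable v)
    (hv : ∀ y, d y < ε → DifferentiableAt ℝ v y) :
    ∫⁻ x in Metric.ball x₀ (r / 2) ∩ {x | d x < ε ∧ 0 ≤ d x},
        ENNReal.ofReal (|v x| * slopeWeight d α ε x) ≤
      ENNReal.ofReal (2 / r * (1 / c) * max r 1) * ∫⁻ x in {x | d x < ε},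
        ENNReal.ofReal ((‖fderiv ℝ v x‖ + |v x|) * truncDist d ε x ^ α) := by
  have hdm := hd.continuous.measurable
  have hWm : Measurable fun x => truncDist d ε x ^ α := (measurable_truncDist hdm).pow_const α
  have hHm : Measurable (slopeWeight d α ε) := measurable_slopeWeight hdm
  have hfm : Measurable fun x => ‖fderiv ℝ v x‖ := (measurable_fderiv ℝ v).norm
  have hφm : Measurable fun x => r - dist x x₀ := by fun_prop
  set B := Metric.ball x₀ r
  set P : Set E := {x | x ∈ B ∧ d x < ε ∧ 0 ≤ d x}
  set Q : Set E := {x | x ∈ B ∧ d x < ε}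
  have hlt : MeasurableSet {x | d x < ε} := measurableSet_lt hdm measurable_const
  have hP : MeasurableSet P := Metric.isOpen_ball.measurableSet.inter
    (hlt.inter (measurableSet_le measurable_const hdm))
  have hQ : MeasurableSet Q := Metric.isOpen_ball.measurableSet.inter hlt
  set f : E → ℝ≥0∞ := fun x => ENNReal.ofReal ((r - dist x x₀) * |v x| * slopeWeight d α ε x)
  set g : E → ℝ≥0∞ := fun x => ENNReal.ofReal ((‖fderiv ℝ v x‖ * (r - dist x x₀) + |v x|) *
    truncDist d ε x ^ α)
  have hf : Measurable f := ((hφm.mul hvm.abs).mul hHm).ennreal_ofReal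
  have hg : Measurable g := (((hfm.mul hφm).add hvm.abs).mul hWm).ennreal_ofReal
  have hline : ∫⁻ x in P, f x ≤ ENNReal.ofReal (1 / c) * ∫⁻ x in Q, g x := by
    rw [← lintegral_indicator hP, ← lintegral_indicator hQ,
      ← lintegral_const_mul _ (hg.indicator hQ)]
    refine lintegral_le_of_forall_line he (hf.indicator hP) ((hg.indicator hQ).const_mul _)
      fun x => ?_
    have hlm : Measurable fun t : ℝ => x + t • e := (lipschitzWith_line x he).continuous.measurable
    have := lintegral_slopeWeight_line_le hd hε hα hvm hv he hr hc hmono x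
    have hgl : Measurable fun t : ℝ => Q.indicator g (x + t • e) := (hg.indicator hQ).comp hlm
    rw [lintegral_const_mul _ hgl]
    have h1 : ∫⁻ t : ℝ, P.indicator f (x + t • e) = ∫⁻ t in (fun t : ℝ => x + t • e) ⁻¹' P,
        f (x + t • e) := by
      rw [← lintegral_indicator (hlm hP)]; rfl
    have h2 : ∫⁻ t : ℝ, Q.indicator g (x + t • e) = ∫⁻ t in (fun t : ℝ => x + t • e) ⁻¹' Q,
        g (x + t • e) := by
      rw [← lintegral_indicator (hlm hQ)]; rfl
    rw [h1, h2]
    exact this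
  have hsub : Metric.ball x₀ (r / 2) ∩ {x | d x < ε ∧ 0 ≤ d x} ⊆ P :=
    fun x hx => ⟨Metric.ball_subset_ball (by linarith) hx.1, hx.2⟩
  calc _ ≤ ∫⁻ x in Metric.ball x₀ (r / 2) ∩ {x | d x < ε ∧ 0 ≤ d x},
        ENNReal.ofReal (2 / r) * f x := by
        refine setLIntegral_mono' (Metric.isOpen_ball.measurableSet.inter
          (hlt.inter (measurableSet_le measurable_const hdm))) fun x hx => ?_
        rw [← ENNReal.ofReal_mul (by positivity)]
        apply ENNReal.ofReal_le_ofReal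
        have h1 : dist x x₀ < r / 2 := hx.1
        have h2 : 1 ≤ 2 / r * (r - dist x x₀) := by
          rw [div_mul_eq_mul_div, le_div_iff₀ hr]; linarith
        have h3 : 0 ≤ |v x| * slopeWeight d α ε x :=
          mul_nonneg (abs_nonneg _) (slopeWeight_nonneg hε hα)
        calc |v x| * slopeWeight d α ε x ≤ 2 / r * (r - dist x x₀) *
              (|v x| * slopeWeight d α ε x) := le_mul_of_one_le_left h3 h2
          _ = _ := by ring
    _ ≤ ∫⁻ x in P, ENNReal.ofReal (2 / r) * f x := lintegral_mono_set hsub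
    _ = ENNReal.ofReal (2 / r) * ∫⁻ x in P, f x := lintegral_const_mul _ hf
    _ ≤ ENNReal.ofReal (2 / r) * (ENNReal.ofReal (1 / c) * ∫⁻ x in Q, g x) := by gcongr
    _ ≤ ENNReal.ofReal (2 / r) * (ENNReal.ofReal (1 / c) * ∫⁻ x in Q, ENNReal.ofReal (max r 1) *
          ENNReal.ofReal ((‖fderiv ℝ v x‖ + |v x|) * truncDist d ε x ^ α)) := by
        gcongr ENNReal.ofReal (2 / r) * (ENNReal.ofReal (1 / c) * ?_)
        refine setLIntegral_mono' hQ fun x hx => ?_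
        rw [← ENNReal.ofReal_mul (by positivity)]
        apply ENNReal.ofReal_le_ofReal
        rw [← mul_assoc, mul_add]
        have h0 : 0 ≤ dist x x₀ := dist_nonneg
        have h3 : 0 ≤ truncDist d ε x ^ α := Real.rpow_nonneg truncDist_nonneg _
        have h4 : ‖fderiv ℝ v x‖ * (r - dist x x₀) ≤ max r 1 * ‖fderiv ℝ v x‖ := by
          rw [mul_comm]; gcongr
          exact (by linarith : r - dist x x₀ ≤ r).trans (le_max_left _ _)
        have h5 : |v x| ≤ max r 1 * |v x| :=
          le_mul_of_one_le_left (abs_nonneg _) (le_max_right _ _)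
        gcongr
    _ = ENNReal.ofReal (2 / r * (1 / c) * max r 1) * ∫⁻ x in Q,
          ENNReal.ofReal ((‖fderiv ℝ v x‖ + |v x|) * truncDist d ε x ^ α) := by
        have hm : Measurable fun x => ENNReal.ofReal ((‖fderiv ℝ v x‖ + |v x|) *
          truncDist d ε x ^ α) := ((hfm.add hvm.abs).mul hWm).ennreal_ofReal
        rw [lintegral_const_mul _ hm,
          ENNReal.ofReal_mul (by positivity), ENNReal.ofReal_mul (by positivity)]
        ring
    _ ≤ _ := by
        gcongr
        exact fun x hx => hx.2

end Hardy

section OrientedDistance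

variable {E : Type*} [NormedAddCommGroup E] {D : Set E} {d : E → ℝ}

/-- A segment joining a set to its complement meets the frontier. -/
theorem exists_mem_frontier_dist_add_dist_eq [NormedSpace ℝ E] {x y : E} (hx : x ∉ D)
    (hy : y ∈ D) : ∃ z ∈ frontier D, dist x z + dist z y = dist x y := by
  suffices h : ∃ z ∈ segment ℝ x y, z ∈ frontier D by
    obtain ⟨z, hz, hzf⟩ := h
    exact ⟨z, hzf, dist_add_dist_of_mem_segment hz⟩
  by_contra! h
  have hcover : ∀ z ∈ segment ℝ x y, z ∈ interior D ∨ z ∈ (closure D)ᶜ := fun z hz => by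
    by_contra! hz'
    exact h z hz ⟨not_not.1 hz'.2, hz'.1⟩
  obtain ⟨z, -, hz, hz'⟩ := (convex_segment (𝕜 := ℝ) x y).isPreconnected (interior D)
    (closure D)ᶜ isOpen_interior isClosed_closure.isOpen_compl hcover
    ⟨y, right_mem_segment ℝ x y, (hcover y (right_mem_segment ℝ x y)).resolve_right
      (not_not.2 (subset_closure hy))⟩
    ⟨x, left_mem_segment ℝ x y, (hcover x (left_mem_segment ℝ x y)).resolve_left
      fun hxi => hx (interior_subset hxi)⟩
  exact hz' (interior_subset_closure hz)

theorem infDist_add_infDist_compl_le_dist [NormedSpace ℝ E] {x y : E} (hx : x ∉ D)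
    (hy : y ∈ D) : Metric.infDist x D + Metric.infDist y Dᶜ ≤ dist x y := by
  obtain ⟨z, hz, hxy⟩ := exists_mem_frontier_dist_add_dist_eq hx hy
  rw [← hxy, dist_comm z y, ← Metric.infDist_closure (s := D),
    ← Metric.infDist_closure (s := Dᶜ)]
  have hz' : z ∈ closure Dᶜ := by
    rw [← frontier_compl] at hz
    exact hz.1
  exact add_le_add (Metric.infDist_le_dist_of_mem hz.1) (Metric.infDist_le_dist_of_mem hz')

theorem orientedDist_of_notMem (hd : ∀ x, d x = Metric.infDist x D - Metric.infDist x Dᶜ)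
    {x : E} (hx : x ∉ D) : d x = Metric.infDist x D := by
  rw [hd, Metric.infDist_zero_of_mem (s := Dᶜ) hx, sub_zero]

theorem orientedDist_of_mem (hd : ∀ x, d x = Metric.infDist x D - Metric.infDist x Dᶜ)
    {x : E} (hx : x ∈ D) : d x = -Metric.infDist x Dᶜ := by
  rw [hd, Metric.infDist_zero_of_mem hx, zero_sub]

theorem lipschitzWith_orientedDist [NormedSpace ℝ E]
    (hd : ∀ x, d x = Metric.infDist x D - Metric.infDist x Dᶜ) : LipschitzWith 1 d := by
  refine LipschitzWith.of_le_add fun x y => ?_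
  by_cases hx : x ∈ D <;> by_cases hy : y ∈ D
  · rw [orientedDist_of_mem hd hx, orientedDist_of_mem hd hy]
    have := Metric.infDist_le_infDist_add_dist (s := Dᶜ) (x := y) (y := x)
    rw [dist_comm] at this
    linarith
  · rw [orientedDist_of_mem hd hx, orientedDist_of_notMem hd hy]
    have h1 := Metric.infDist_nonneg (s := Dᶜ) (x := x)
    have h2 := Metric.infDist_nonneg (s := D) (x := y)
    have h3 : 0 ≤ dist x y := dist_nonneg
    linarith
  · rw [orientedDist_of_notMem hd hx, orientedDist_of_mem hd hy]
    have := infDist_add_infDist_compl_le_dist hx hy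
    linarith
  · rw [orientedDist_of_notMem hd hx, orientedDist_of_notMem hd hy]
    exact Metric.infDist_le_infDist_add_dist

theorem isBounded_sublevel_orientedDist (hD : Bornology.IsBounded D) (hne : D.Nonempty)
    (hd : ∀ x, d x = Metric.infDist x D - Metric.infDist x Dᶜ) (t : ℝ) :
    Bornology.IsBounded {x | d x ≤ t} := by
  refine (hD.thickening (δ := max t 0 + 1)).subset fun x hx => ?_
  rw [Metric.mem_thickening_iff_infDist_lt hne]
  refine lt_of_le_of_lt ?_ (lt_add_one _)
  by_cases hxD : x ∈ D
  · rw [Metric.infDist_zero_of_mem hxD]; exact le_max_right _ _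
  · rw [← orientedDist_of_notMem hd hxD]; exact le_max_of_le_left hx

/-- `d` decreases at a definite rate in a fixed direction near `x₀`. -/
def HasDescentDirection [NormedSpace ℝ E] (d : E → ℝ) (x₀ : E) : Prop :=
  ∃ (e : E) (c r : ℝ), ‖e‖ = 1 ∧ 0 < c ∧ 0 < r ∧ ∀ y ∈ Metric.ball x₀ r, ∀ t : ℝ, 0 ≤ t →
    y + t • e ∈ Metric.ball x₀ r → d (y + t • e) ≤ d y - c * t

theorem hasDescentDirection_of_hasStrictFDerivAt [NormedSpace ℝ E] {f' : E →L[ℝ] ℝ} {x₀ : E}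
    (h : HasStrictFDerivAt d f' x₀) (hf' : f' ≠ 0) : HasDescentDirection d x₀ := by
  obtain ⟨w, hw⟩ : ∃ w, f' w ≠ 0 := by
    by_contra! H
    exact hf' (ContinuousLinearMap.ext H)
  have hw0 : 0 < ‖w‖ := norm_pos_iff.2 fun h0 => hw (by simp [h0])
  have hex : ∃ e : E, ‖e‖ = 1 ∧ f' e < 0 := by
    rcases hw.lt_or_gt with hneg | hpos
    · refine ⟨‖w‖⁻¹ • w, by rw [norm_smul, norm_inv, norm_norm, inv_mul_cancel₀ hw0.ne'], ?_⟩
      rw [map_smul, smul_eq_mul]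
      exact mul_neg_of_pos_of_neg (inv_pos.2 hw0) hneg
    · refine ⟨-(‖w‖⁻¹ • w), by
        rw [norm_neg, norm_smul, norm_inv, norm_norm, inv_mul_cancel₀ hw0.ne'], ?_⟩
      rw [map_neg, map_smul, smul_eq_mul]
      exact neg_neg_of_pos (mul_pos (inv_pos.2 hw0) hpos)
  obtain ⟨e, he, hfe⟩ := hex
  set c : NNReal := ⟨-f' e / 2, by linarith⟩
  have hc : (c : ℝ) = -f' e / 2 := rfl
  obtain ⟨s, hs, happ⟩ := h.approximates_deriv_on_nhds (c := c)
    (Or.inr (by rw [← NNReal.coe_pos, hc]; linarith))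
  obtain ⟨r, hr, hrs⟩ := Metric.mem_nhds_iff.1 hs
  refine ⟨e, c, r, he, by rw [hc]; linarith, hr, fun y hy t ht hyt => ?_⟩
  have h1 := happ _ (hrs hyt) _ (hrs hy)
  rw [add_sub_cancel_left, norm_smul, he, mul_one, map_smul, smul_eq_mul, Real.norm_eq_abs,
    Real.norm_eq_abs, abs_of_nonneg ht] at h1
  have h2 := (abs_le.1 h1).2
  rw [hc] at h2 ⊢
  linarith

theorem fderiv_orientedDist_ne_zero [NormedSpace ℝ E] [ProperSpace E] (hDo : IsOpen D)
    (hd : ∀ x, d x = Metric.infDist x D - Metric.infDist x Dᶜ) {f' : E →L[ℝ] ℝ} {x₀ : E}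
    (hx₀ : x₀ ∈ frontier D) (h : HasStrictFDerivAt d f' x₀) : f' ≠ 0 := by
  rintro rfl
  obtain ⟨s, hs, happ⟩ := h.approximates_deriv_on_nhds (c := 1 / 2) (Or.inr (by norm_num))
  obtain ⟨r, hr, hrs⟩ := Metric.mem_nhds_iff.1 hs
  obtain ⟨x, hxD, hx⟩ := Metric.mem_closure_iff.1 hx₀.1 (r / 2) (by linarith)
  have hx₀' : x₀ ∈ Dᶜ := fun hmem => hx₀.2 (hDo.interior_eq.symm ▸ hmem)
  obtain ⟨y, hy, hxy⟩ := hDo.isClosed_compl.exists_infDist_eq_dist ⟨x₀, hx₀'⟩ x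
  have hle : dist x y ≤ dist x x₀ := hxy ▸ Metric.infDist_le_dist_of_mem hx₀'
  have hpos : 0 < dist x y := dist_pos.2 fun hEq => hy (hEq ▸ hxD)
  rw [dist_comm] at hx
  have hyb : y ∈ Metric.ball x₀ r := by
    have := dist_triangle y x x₀
    rw [dist_comm y x] at this
    rw [Metric.mem_ball]
    linarith
  have h1 := happ _ (hrs hyb) x (hrs (Metric.mem_ball.2 (by linarith)))
  rw [zero_apply, sub_zero, ← dist_eq_norm, ← dist_eq_norm, dist_comm y x,
    orientedDist_of_mem hd hxD, orientedDist_of_notMem hd hy, hxy, Real.dist_eq] at h1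
  have h2 := le_abs_self (Metric.infDist y D - -dist x y)
  have h3 := Metric.infDist_nonneg (s := D) (x := y)
  push_cast at h1
  linarith

/-- Outside an open set, nearest points of the closure lie on the frontier. -/
theorem mem_frontier_of_dist_eq_infDist [NormedSpace ℝ E] (hDo : IsOpen D) {x y : E}
    (hx : x ∉ D) (hy : y ∈ closure D) (hxy : dist x y = Metric.infDist x D) :
    y ∈ frontier D := by
  rw [hDo.frontier_eq]
  refine ⟨hy, fun hyD => ?_⟩
  obtain ⟨z, hz, hzd⟩ := exists_mem_frontier_dist_add_dist_eq hx hyD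
  have h1 : Metric.infDist x D ≤ dist x z := by
    rw [← Metric.infDist_closure]
    exact Metric.infDist_le_dist_of_mem hz.1
  have h2 : dist z y = 0 := le_antisymm (by linarith) dist_nonneg
  rw [hDo.frontier_eq] at hz
  exact hz.2 (dist_eq_zero.1 h2 ▸ hyD)

theorem infDist_frontier_eq [NormedSpace ℝ E] [ProperSpace E] (hDo : IsOpen D)
    (hne : D.Nonempty) {x : E} (hx : x ∉ D) :
    Metric.infDist x (frontier D) = Metric.infDist x D := by
  obtain ⟨y, hy, hxy⟩ := isClosed_closure.exists_infDist_eq_dist hne.closure x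
  rw [Metric.infDist_closure] at hxy
  have hyf := mem_frontier_of_dist_eq_infDist hDo hx hy hxy.symm
  refine le_antisymm (hxy ▸ Metric.infDist_le_dist_of_mem hyf) ?_
  rw [← Metric.infDist_closure (s := D)]
  exact Metric.infDist_le_infDist_of_subset sdiff_subset ⟨y, hyf⟩

/-- Stability of a unique nearest point. -/
theorem exists_forall_nearest_mem_ball {K : Set E} (hK : IsCompact K) {x₀ y₀ : E}
    (huniq : ∀ y ∈ K, dist x₀ y = Metric.infDist x₀ K → y = y₀) {η : ℝ} (hη : 0 < η) :
    ∃ r > 0, ∀ x ∈ Metric.ball x₀ r, ∀ y ∈ K, dist x y = Metric.infDist x K →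
      dist y y₀ < η := by
  rcases (K \ Metric.ball y₀ η).eq_empty_or_nonempty with hempty | hnonempty
  · refine ⟨1, one_pos, fun x _ y hy _ => ?_⟩
    by_contra hlt
    exact (hempty ▸ (⟨hy, hlt⟩ : y ∈ K \ Metric.ball y₀ η) : y ∈ (∅ : Set E))
  · obtain ⟨k, hk, hkd⟩ := (hK.diff Metric.isOpen_ball).exists_infDist_eq_dist hnonempty x₀
    have hgap : Metric.infDist x₀ K < dist x₀ k := by
      refine lt_of_le_of_ne (Metric.infDist_le_dist_of_mem hk.1) fun hEq => hk.2 ?_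
      rw [huniq k hk.1 hEq.symm]
      exact Metric.mem_ball_self hη
    refine ⟨(dist x₀ k - Metric.infDist x₀ K) / 2, by linarith, fun x hx y hy hxy => ?_⟩
    by_contra hlt
    have h1 : dist x₀ k ≤ dist x₀ y := hkd ▸ Metric.infDist_le_dist_of_mem ⟨hy, hlt⟩
    have h2 := dist_triangle x₀ x y
    have h3 := Metric.infDist_le_infDist_add_dist (s := K) (x := x) (y := x₀)
    rw [Metric.mem_ball] at hx
    rw [dist_comm x₀ x] at h2
    linarith

theorem norm_add_smul_le_of_near [InnerProductSpace ℝ E] {e z : E} (he : ‖e‖ = 1) {R t : ℝ}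
    (hz : ‖z + R • e‖ ≤ R / 4) (ht : 0 ≤ t) (htR : t ≤ R / 2) :
    ‖z + t • e‖ ≤ ‖z‖ - 1 / 4 * t := by
  have hR : 0 ≤ R := by linarith
  have h1 : inner ℝ z e ≤ -(3 / 4 * R) := by
    have h2 : inner ℝ (z + R • e) e ≤ R / 4 := by
      have := real_inner_le_norm (z + R • e) e
      rw [he, mul_one] at this
      exact this.trans hz
    rw [inner_add_left, real_inner_smul_left, real_inner_self_eq_norm_sq, he] at h2
    linarith
  have hRe : ‖R • e‖ = R := by rw [norm_smul, he, mul_one, Real.norm_eq_abs, abs_of_nonneg hR]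
  have h3 : ‖z‖ ≤ 5 / 4 * R := by
    have := norm_sub_le (z + R • e) (R • e)
    rw [add_sub_cancel_right, hRe] at this
    linarith
  have h4 : 3 / 4 * R ≤ ‖z‖ := by
    have := norm_sub_le (z + R • e) z
    rw [add_sub_cancel_left, hRe] at this
    linarith
  refine abs_le_of_sq_le_sq' ?_ (by linarith) |>.2
  rw [norm_add_sq_real, norm_smul, he, mul_one, Real.norm_eq_abs, sq_abs, inner_smul_right]
  nlinarith [mul_le_mul_of_nonneg_left h1 ht, mul_le_mul_of_nonneg_left h3 ht,
    mul_le_mul_of_nonneg_left htR ht, sq_nonneg t]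

theorem hasDescentDirection_of_unique_projection [InnerProductSpace ℝ E] [ProperSpace E]
    (hDo : IsOpen D) (hDb : Bornology.IsBounded D) (hne : D.Nonempty)
    (hd : ∀ x, d x = Metric.infDist x D - Metric.infDist x Dᶜ) {x₀ : E} (hx₀ : 0 < d x₀)
    (huniq : ∃! y, y ∈ frontier D ∧ dist x₀ y = Metric.infDist x₀ (frontier D)) :
    HasDescentDirection d x₀ := by
  have hout : ∀ x, 0 < d x → x ∉ D := fun x hx hxD => by
    rw [orientedDist_of_mem hd hxD] at hx
    have := Metric.infDist_nonneg (s := Dᶜ) (x := x)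
    linarith
  obtain ⟨y₀, ⟨hy₀f, hy₀d⟩, hy₀u⟩ := huniq
  rw [infDist_frontier_eq hDo hne (hout _ hx₀)] at hy₀d hy₀u
  set R := d x₀
  have hR : dist x₀ y₀ = R := hy₀d.trans (orientedDist_of_notMem hd (hout _ hx₀)).symm
  obtain ⟨r₁, hr₁, hnear⟩ := exists_forall_nearest_mem_ball
    (hDb.isCompact_closure) (x₀ := x₀) (y₀ := y₀) (fun y hy hxy => by
      rw [Metric.infDist_closure] at hxy
      exact hy₀u y ⟨mem_frontier_of_dist_eq_infDist hDo (hout _ hx₀) hy hxy, hxy⟩)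
    (show 0 < R / 8 by linarith)
  set e : E := R⁻¹ • (y₀ - x₀)
  have hRe : R • e = y₀ - x₀ := smul_inv_smul₀ hx₀.ne' _
  have he : ‖e‖ = 1 := by
    rw [norm_smul, ← dist_eq_norm, dist_comm, hR, norm_inv, Real.norm_eq_abs, abs_of_pos hx₀,
      inv_mul_cancel₀ hx₀.ne']
  refine ⟨e, 1 / 4, min r₁ (R / 8), he, by norm_num, lt_min hr₁ (by linarith), ?_⟩
  intro y hy t ht hyt
  have hyr : dist y x₀ < R / 8 := lt_of_lt_of_le hy (min_le_right _ _)
  have hytr : dist (y + t • e) x₀ < R / 8 := lt_of_lt_of_le hyt (min_le_right _ _)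
  have htR : t ≤ R / 2 := by
    have h1 := dist_triangle_right (y + t • e) y x₀
    rw [dist_eq_norm, add_sub_cancel_left, norm_smul, he, mul_one, Real.norm_eq_abs,
      abs_of_nonneg ht] at h1
    linarith
  have hdy : 0 < d y := by
    have h1 := (lipschitzWith_orientedDist hd).dist_le_mul y x₀
    rw [Real.dist_eq, NNReal.coe_one, one_mul] at h1
    have h2 := (abs_le.1 h1).1
    change -dist y x₀ ≤ d y - R at h2
    linarith
  obtain ⟨y', hy', hyy'⟩ := isClosed_closure.exists_infDist_eq_dist hne.closure y
  have hy'₀ := hnear y (Metric.ball_subset_ball (min_le_left _ _) hy) y' hy' hyy'.symm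
  have hz : ‖(y - y') + R • e‖ ≤ R / 4 := by
    have h1 : (y - y') + R • e = (y - x₀) - (y' - y₀) := by rw [hRe]; abel
    rw [h1]
    have h2 := norm_sub_le (y - x₀) (y' - y₀)
    rw [← dist_eq_norm y, ← dist_eq_norm y'] at h2
    linarith
  have hfin := norm_add_smul_le_of_near he hz ht htR
  rw [orientedDist_of_notMem hd (hout _ hdy), ← Metric.infDist_closure, hyy', dist_eq_norm]
  refine le_trans ?_ hfin
  have h1 : y - y' + t • e = (y + t • e) - y' := by abel
  rw [h1, ← dist_eq_norm, hd, ← Metric.infDist_closure (s := D)]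
  have h2 := Metric.infDist_nonneg (s := Dᶜ) (x := y + t • e)
  have h3 := Metric.infDist_le_dist_of_mem (x := y + t • e) hy'
  linarith

theorem mem_frontier_of_orientedDist_eq_zero (hDo : IsOpen D) (hne : D.Nonempty)
    (hne' : Dᶜ.Nonempty) (hd : ∀ x, d x = Metric.infDist x D - Metric.infDist x Dᶜ) {x : E}
    (hx : d x = 0) : x ∈ frontier D := by
  have hxD : x ∉ D := fun hxD => by
    rw [orientedDist_of_mem hd hxD, neg_eq_zero] at hx
    exact (hDo.isClosed_compl.mem_iff_infDist_zero hne').2 hx hxD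
  rw [hDo.frontier_eq]
  refine ⟨(Metric.mem_closure_iff_infDist_zero hne).2 ?_, hxD⟩
  rw [← orientedDist_of_notMem hd hxD, hx]

/-- The oriented distance function of a bounded domain with regular boundary and unique
projections has descent directions on the outer tubular neighbourhood. -/
theorem hasDescentDirection_orientedDist [InnerProductSpace ℝ E] [ProperSpace E] [Nontrivial E]
    (hDo : IsOpen D) (hDb : Bornology.IsBounded D) (hne : D.Nonempty)
    (hd : ∀ x, d x = Metric.infDist x D - Metric.infDist x Dᶜ) {U : Set E} (hU : IsOpen U)
    (hDU : frontier D ⊆ U) (hC1 : ContDiffOn ℝ 1 d U) {δ : ℝ}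
    (hproj : ∀ z ∈ {x | d x < δ} \ closure {x | d x < -δ},
      ∃! y, y ∈ frontier D ∧ dist z y = Metric.infDist z (frontier D)) {x₀ : E}
    (h0 : 0 ≤ d x₀) (hx₀ : d x₀ < δ) : HasDescentDirection d x₀ := by
  rcases h0.eq_or_lt with h | h
  · have hne' : Dᶜ.Nonempty := by
      rw [nonempty_compl]
      rintro rfl
      exact NormedSpace.unbounded_univ ℝ E hDb
    have hf := mem_frontier_of_orientedDist_eq_zero hDo hne hne' hd h.symm
    have hstrict := (hC1.contDiffAt (hU.mem_nhds (hDU hf))).hasStrictFDerivAt one_ne_zero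
    exact hasDescentDirection_of_hasStrictFDerivAt hstrict
      (fderiv_orientedDist_ne_zero hDo hd hf hstrict)
  · refine hasDescentDirection_of_unique_projection hDo hDb hne hd h (hproj _ ⟨hx₀, fun hmem => ?_⟩)
    have : x₀ ∈ {x | d x ≤ -δ} := closure_minimal (fun x hx => le_of_lt hx)
      (isClosed_le (lipschitzWith_orientedDist hd).continuous continuous_const) hmem
    have : d x₀ ≤ -δ := this
    linarith

end OrientedDistance

section GlobalHardy

variable {E : Type*} [NormedAddCommGroup E] [InnerProductSpace ℝ E] [FiniteDimensional ℝ E]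
  [MeasurableSpace E] [BorelSpace E] {d : E → ℝ} {α : ℝ}

/-- Hardy's inequality, with a constant uniform in `ε ∈ (0, ε₀)`. -/
theorem exists_lintegral_slopeWeight_le (hd : LipschitzWith 1 d) (hα : 0 < α) {ε₀ : ℝ}
    (hK : IsCompact {x | 0 ≤ d x ∧ d x ≤ ε₀})
    (hdesc : ∀ x, 0 ≤ d x → d x ≤ ε₀ → HasDescentDirection d x) :
    ∃ C : NNReal, ∀ ε ∈ Ioo 0 ε₀, ∀ v : E → ℝ, Measurable v →
      (∀ y, d y < ε → DifferentiableAt ℝ v y) →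
      ∫⁻ x in {x | d x < ε}, ENNReal.ofReal (|v x| * slopeWeight d α ε x) ≤
        C * ∫⁻ x in {x | d x < ε},
          ENNReal.ofReal ((‖fderiv ℝ v x‖ + |v x|) * truncDist d ε x ^ α) := by
  suffices h : ∃ C : NNReal, ∀ ε ∈ Ioo 0 ε₀, ∀ v : E → ℝ, Measurable v →
      (∀ y, d y < ε → DifferentiableAt ℝ v y) →
      ∫⁻ x in {x | 0 ≤ d x ∧ d x ≤ ε₀} ∩ {x | d x < ε ∧ 0 ≤ d x},
        ENNReal.ofReal (|v x| * slopeWeight d α ε x) ≤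
        C * ∫⁻ x in {x | d x < ε},
          ENNReal.ofReal ((‖fderiv ℝ v x‖ + |v x|) * truncDist d ε x ^ α) by
    obtain ⟨C, hC⟩ := h
    refine ⟨C, fun ε hε v hvm hv => le_trans ?_ (hC ε hε v hvm hv)⟩
    have hdm := hd.continuous.measurable
    rw [← lintegral_indicator (measurableSet_lt hdm measurable_const), ← lintegral_indicator]
    · refine lintegral_mono fun x => ?_
      by_cases h1 : d x < ε
      · by_cases h2 : 0 ≤ d x
        · rw [indicator_of_mem (show x ∈ {x | d x < ε} from h1), indicator_of_mem]
          exact ⟨⟨h2, (h1.trans hε.2).le⟩, h1, h2⟩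
        · rw [indicator_of_mem (show x ∈ {x | d x < ε} from h1)]
          simp [slopeWeight, h2]
      · rw [indicator_of_notMem (show x ∉ {x | d x < ε} from h1)]
        exact zero_le
    · exact ((measurableSet_le measurable_const hdm).inter
        (measurableSet_le hdm measurable_const)).inter
        ((measurableSet_lt hdm measurable_const).inter (measurableSet_le measurable_const hdm))
  refine hK.induction_on (p := fun s => ∃ C : NNReal, ∀ ε ∈ Ioo 0 ε₀, ∀ v : E → ℝ,
      Measurable v → (∀ y, d y < ε → DifferentiableAt ℝ v y) →
      ∫⁻ x in s ∩ {x | d x < ε ∧ 0 ≤ d x}, ENNReal.ofReal (|v x| * slopeWeight d α ε x) ≤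
        C * ∫⁻ x in {x | d x < ε},
          ENNReal.ofReal ((‖fderiv ℝ v x‖ + |v x|) * truncDist d ε x ^ α)) ?_ ?_ ?_ ?_
  · exact ⟨0, fun ε _ v _ _ => by simp⟩
  · rintro s t hst ⟨C, hC⟩
    exact ⟨C, fun ε hε v hvm hv => (lintegral_mono_set (inter_subset_inter_left _ hst)).trans
      (hC ε hε v hvm hv)⟩
  · rintro s t ⟨C, hC⟩ ⟨C', hC'⟩
    refine ⟨C + C', fun ε hε v hvm hv => ?_⟩
    rw [union_inter_distrib_right, ENNReal.coe_add, add_mul]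
    exact (lintegral_union_le _ _ _).trans (add_le_add (hC ε hε v hvm hv) (hC' ε hε v hvm hv))
  · rintro x ⟨hx0, hx1⟩
    obtain ⟨e, c, r, he, hc, hr, hmono⟩ := hdesc x hx0 hx1
    exact ⟨Metric.ball x (r / 2),
      mem_nhdsWithin_of_mem_nhds (Metric.ball_mem_nhds x (by linarith)),
      (2 / r * (1 / c) * max r 1).toNNReal, fun ε hε v hvm hv =>
        lintegral_slopeWeight_halfBall_le hd hα he hr hc hmono hε.1 hvm hv⟩

end GlobalHardy

section GridLines

/-- The grid-lines lemma on Euclidean space. -/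
theorem lintegral_mul_prod_lintegral_line_le {n : ℕ} {p : ℝ} (hp₀ : 0 ≤ p)
    (hp : ((n : ℝ) - 1) * p ≤ 1) {F : EuclideanSpace ℝ (Fin n) → ℝ≥0∞} (hF : Measurable F) :
    ∫⁻ x, F x ^ (1 - ((n : ℝ) - 1) * p) *
        ∏ i, (∫⁻ t : ℝ, F (x + t • EuclideanSpace.single i 1)) ^ p ≤
      (∫⁻ x, F x) ^ (1 + p) := by
  have hmp := PiLp.volume_preserving_toLp (Fin n)
  have hemb : MeasurableEmbedding (WithLp.toLp 2 : (Fin n → ℝ) → EuclideanSpace ℝ (Fin n)) :=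
    (MeasurableEquiv.toLp 2 (Fin n → ℝ)).measurableEmbedding
  rw [← hmp.lintegral_comp_emb hemb, ← hmp.lintegral_comp_emb hemb]
  have h := lintegral_mul_prod_lintegral_pow_le (fun _ : Fin n => (volume : Measure ℝ)) hp₀
    (by simpa using hp) (hF.comp hemb.measurable)
  rw [Fintype.card_fin] at h
  refine le_trans (le_of_eq ?_) h
  rw [← volume_pi]
  refine lintegral_congr fun y => ?_
  congr 1
  refine Finset.prod_congr rfl fun i _ => ?_
  congr 1
  rw [← lintegral_add_right_eq_self
    (fun t : ℝ => (F ∘ WithLp.toLp 2) (Function.update y i t)) (y i)]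
  refine lintegral_congr fun t => ?_
  simp only [Function.comp]
  congr 1
  ext j
  rcases eq_or_ne j i with rfl | hj
  · simp [add_comm]
  · simp [hj]

end GridLines

section WeightedGagliardo

variable {n : ℕ} {d : EuclideanSpace ℝ (Fin n) → ℝ} {α : ℝ}

theorem weight_rpow_identity {N ρ a c : ℝ} (hα : 0 < α) (hN : 1 < N) (hnN : (n : ℝ) + α = N)
    (hρ : 0 < ρ) (ha : 0 ≤ a) (hc : 0 ≤ c) :
    (a * (c * ρ ^ (α - 1))) ^ (α / (N - 1)) * ((ρ ^ α * a) ^ (1 / (N - 1))) ^ n =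
      c ^ (α / (N - 1)) * (a ^ (N / (N - 1)) * ρ ^ α) := by
  have hN1 : N - 1 ≠ 0 := by linarith
  rcases ha.eq_or_lt with rfl | ha
  · have h1 : α / (N - 1) ≠ 0 := div_ne_zero hα.ne' hN1
    have h2 : N / (N - 1) ≠ 0 := div_ne_zero (by linarith) hN1
    simp [Real.zero_rpow h1, Real.zero_rpow h2]
  have hn : (n : ℝ) = N - α := by linarith
  rw [← Real.rpow_natCast, ← Real.rpow_mul (by positivity),
    Real.mul_rpow (by positivity) (by positivity),
    Real.mul_rpow hc (by positivity), Real.mul_rpow (by positivity) (by positivity),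
    ← Real.rpow_mul hρ.le, ← Real.rpow_mul hρ.le, hn]
  have h1 : N / (N - 1) = α / (N - 1) + 1 / (N - 1) * (N - α) := by field_simp; ring
  have h2 : ρ ^ α = ρ ^ ((α - 1) * (α / (N - 1))) * ρ ^ (α * (1 / (N - 1) * (N - α))) := by
    rw [← Real.rpow_add hρ]
    congr 1
    field_simp
    ring
  rw [h1, Real.rpow_add ha, h2]
  ring

/-- The weighted Gagliardo–Nirenberg inequality with exponent one, up to a boundary term. -/
theorem lintegral_rpow_weight_le_slopeWeight (hn : 2 ≤ n) (hd : LipschitzWith 1 d) (hα : 0 < α)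
    {ε ε₀ : ℝ} (hε : ε ∈ Ioo 0 ε₀) (hbdd : Bornology.IsBounded {y | d y < ε})
    {v : EuclideanSpace ℝ (Fin n) → ℝ} (hvm : Measurable v)
    (hv : ∀ y, d y < ε → DifferentiableAt ℝ v y) :
    ENNReal.ofReal (min 1 (α / ε₀) ^ (α / (n + α - 1))) *
        ∫⁻ x in {x | d x < ε},
          ENNReal.ofReal (|v x| ^ ((n + α) / (n + α - 1)) * truncDist d ε x ^ α) ≤
      (∫⁻ x in {x | d x < ε}, ENNReal.ofReal (‖fderiv ℝ v x‖ * truncDist d ε x ^ α +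
        |v x| * (slopeWeight d α ε x + truncDist d ε x ^ α))) ^ ((n + α) / (n + α - 1)) := by
  have hn' : (2 : ℝ) ≤ n := by exact_mod_cast hn
  have hN1 : 0 < (n : ℝ) + α - 1 := by linarith
  have hε₀ : 0 < ε₀ := hε.1.trans hε.2
  have hc : 0 ≤ min 1 (α / ε₀) := by positivity
  have hdm := hd.continuous.measurable
  have hO : MeasurableSet {x | d x < ε} := measurableSet_lt hdm measurable_const
  have hWm : Measurable fun x => truncDist d ε x ^ α := (measurable_truncDist hdm).pow_const α
  have hHm : Measurable (slopeWeight d α ε) := measurable_slopeWeight hdm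
  have hfm : Measurable fun x => ‖fderiv ℝ v x‖ := (measurable_fderiv ℝ v).norm
  set G : EuclideanSpace ℝ (Fin n) → ℝ≥0∞ := fun x =>
    ENNReal.ofReal (‖fderiv ℝ v x‖ * truncDist d ε x ^ α +
      |v x| * (slopeWeight d α ε x + truncDist d ε x ^ α))
  have hG : Measurable G := ((hfm.mul hWm).add (hvm.abs.mul (hHm.add hWm))).ennreal_ofReal
  have hvW : Measurable fun x =>
      ENNReal.ofReal (|v x| ^ ((n + α) / (n + α - 1)) * truncDist d ε x ^ α) :=
    ((hvm.abs.pow_const _).mul hWm).ennreal_ofReal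
  have hgrid := lintegral_mul_prod_lintegral_line_le (p := 1 / (n + α - 1)) (by positivity)
    (by rw [mul_one_div, div_le_one hN1]; linarith) (hG.indicator hO)
  have h1 : 1 - ((n : ℝ) - 1) * (1 / (n + α - 1)) = α / (n + α - 1) := by field_simp; ring
  have h2 : 1 + 1 / ((n : ℝ) + α - 1) = (n + α) / (n + α - 1) := by field_simp; ring
  rw [h1, h2, lintegral_indicator hO] at hgrid
  refine le_trans ?_ hgrid
  rw [← lintegral_indicator hO, ← lintegral_const_mul _ (hvW.indicator hO)]
  refine lintegral_mono fun x => ?_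
  by_cases hx : d x < ε
  swap
  · rw [indicator_of_notMem (show x ∉ {x | d x < ε} from hx), mul_zero]
    exact zero_le
  have hx' : x ∈ {x | d x < ε} := hx
  rw [indicator_of_mem hx', indicator_of_mem hx']
  have hρ := (truncDist_pos_iff hε.1).2 hx
  have hline : ∀ i : Fin n, ENNReal.ofReal (truncDist d ε x ^ α * |v x|) ≤
      ∫⁻ t : ℝ, {x | d x < ε}.indicator G (x + t • EuclideanSpace.single i 1) := by
    intro i
    have hlm : Measurable fun t : ℝ =>
        x + t • (EuclideanSpace.single i 1 : EuclideanSpace ℝ (Fin n)) :=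
      (lipschitzWith_line x (by simp)).continuous.measurable
    have hlO : MeasurableSet {t : ℝ | d (x + t • EuclideanSpace.single i 1) < ε} := hlm hO
    refine (weight_mul_abs_le_lintegral_line hd hε.1 hα hbdd hv
      (e := EuclideanSpace.single i 1) (by simp) x).trans ?_
    rw [← lintegral_indicator hlO]
    refine lintegral_mono fun t => ?_
    by_cases ht : d (x + t • EuclideanSpace.single i 1) < ε
    · rw [indicator_of_mem (by exact ht), indicator_of_mem (by exact ht)]
      refine ENNReal.ofReal_le_ofReal ?_
      have : 0 ≤ truncDist d ε (x + t • EuclideanSpace.single i 1) ^ α :=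
        Real.rpow_nonneg truncDist_nonneg _
      gcongr
      linarith
    · rw [indicator_of_notMem (by exact ht)]
      exact zero_le
  have hpoint : ENNReal.ofReal (|v x| * (min 1 (α / ε₀) * truncDist d ε x ^ (α - 1))) ≤ G x := by
    refine ENNReal.ofReal_le_ofReal ?_
    refine (mul_le_mul_of_nonneg_left (slopeWeight_add_ge hε.1 hε.2.le hα)
      (abs_nonneg (v x))).trans (le_add_of_nonneg_left ?_)
    positivity
  calc _ = ENNReal.ofReal (|v x| * (min 1 (α / ε₀) * truncDist d ε x ^ (α - 1))) ^
          (α / ((n : ℝ) + α - 1)) * ∏ _i : Fin n,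
          ENNReal.ofReal (truncDist d ε x ^ α * |v x|) ^ (1 / ((n : ℝ) + α - 1)) := by
        rw [Finset.prod_const, Finset.card_univ, Fintype.card_fin,
          ENNReal.ofReal_rpow_of_nonneg (by positivity) (by positivity),
          ENNReal.ofReal_rpow_of_nonneg (by positivity) (by positivity),
          ← ENNReal.ofReal_pow (by positivity), ← ENNReal.ofReal_mul (by positivity),
          ← ENNReal.ofReal_mul (by positivity),
          weight_rpow_identity hα (by linarith) rfl hρ (abs_nonneg _) hc]
    _ ≤ _ := by
        gcongr with i
        exact hline i

/-- The weighted Gagliardo–Nirenberg inequality with exponent one, uniformly in `ε`. -/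
theorem exists_lintegral_rpow_weight_le (hn : 2 ≤ n) (hd : LipschitzWith 1 d) (hα : 0 < α)
    {ε₀ : ℝ} (hε₀ : 0 < ε₀) (hbdd : Bornology.IsBounded {y | d y ≤ ε₀})
    (hdesc : ∀ x, 0 ≤ d x → d x ≤ ε₀ → HasDescentDirection d x) :
    ∃ C : NNReal, ∀ ε ∈ Ioo 0 ε₀, ∀ v : EuclideanSpace ℝ (Fin n) → ℝ, Measurable v →
      (∀ y, d y < ε → DifferentiableAt ℝ v y) →
      ∫⁻ x in {x | d x < ε},
          ENNReal.ofReal (|v x| ^ ((n + α) / (n + α - 1)) * truncDist d ε x ^ α) ≤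
        C * (∫⁻ x in {x | d x < ε}, ENNReal.ofReal ((‖fderiv ℝ v x‖ + |v x|) *
          truncDist d ε x ^ α)) ^ ((n + α) / (n + α - 1)) := by
  have hn' : (2 : ℝ) ≤ n := by exact_mod_cast hn
  have hN1 : 0 < (n : ℝ) + α - 1 := by linarith
  have hK : IsCompact {x | 0 ≤ d x ∧ d x ≤ ε₀} :=
    Metric.isCompact_of_isClosed_isBounded
      ((isClosed_le continuous_const hd.continuous).inter
        (isClosed_le hd.continuous continuous_const)) (hbdd.subset fun x hx => hx.2)
  obtain ⟨C, hC⟩ := exists_lintegral_slopeWeight_le hd hα hK hdesc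
  set s := ((n : ℝ) + α) / (n + α - 1)
  have hs : 0 ≤ s := by positivity
  set κ : ℝ := min 1 (α / ε₀) ^ (α / (n + α - 1))
  have hκ : 0 < κ := by positivity
  refine ⟨κ⁻¹.toNNReal * (1 + C) ^ s, fun ε hε v hvm hv => ?_⟩
  have h1 := lintegral_rpow_weight_le_slopeWeight hn hd hα hε
    (hbdd.subset fun x hx => (le_of_lt hx).trans hε.2.le) hvm hv
  have h2 := hC ε hε v hvm hv
  have hdm := hd.continuous.measurable
  have hWm : Measurable fun x => truncDist d ε x ^ α := (measurable_truncDist hdm).pow_const α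
  have hfm : Measurable fun x => ‖fderiv ℝ v x‖ := (measurable_fderiv ℝ v).norm
  set A := ∫⁻ x in {x | d x < ε},
    ENNReal.ofReal ((‖fderiv ℝ v x‖ + |v x|) * truncDist d ε x ^ α)
  have h3 : ∫⁻ x in {x | d x < ε}, ENNReal.ofReal (‖fderiv ℝ v x‖ * truncDist d ε x ^ α +
        |v x| * (slopeWeight d α ε x + truncDist d ε x ^ α)) ≤ (1 + C) * A := by
    have hAm : Measurable fun x =>
        ENNReal.ofReal ((‖fderiv ℝ v x‖ + |v x|) * truncDist d ε x ^ α) :=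
      ((hfm.add hvm.abs).mul hWm).ennreal_ofReal
    rw [add_mul, one_mul]
    refine le_trans (le_of_eq ?_) (add_le_add_right h2 A)
    rw [← lintegral_add_left hAm]
    refine lintegral_congr fun x => ?_
    have hW : 0 ≤ truncDist d ε x ^ α := Real.rpow_nonneg truncDist_nonneg _
    rw [← ENNReal.ofReal_add (by positivity)
      (mul_nonneg (abs_nonneg _) (slopeWeight_nonneg hε.1 hα))]
    congr 1
    ring
  have hκ' : ENNReal.ofReal κ⁻¹ * ENNReal.ofReal κ = 1 := by
    rw [← ENNReal.ofReal_mul (by positivity), inv_mul_cancel₀ hκ.ne', ENNReal.ofReal_one]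
  calc ∫⁻ x in {x | d x < ε}, ENNReal.ofReal (|v x| ^ s * truncDist d ε x ^ α)
      = ENNReal.ofReal κ⁻¹ * (ENNReal.ofReal κ *
          ∫⁻ x in {x | d x < ε}, ENNReal.ofReal (|v x| ^ s * truncDist d ε x ^ α)) := by
        rw [← mul_assoc, hκ', one_mul]
    _ ≤ ENNReal.ofReal κ⁻¹ * ((1 + C) * A) ^ s := by
        gcongr
        exact h1.trans (ENNReal.rpow_le_rpow h3 hs)
    _ = _ := by
        rw [ENNReal.mul_rpow_of_nonneg _ _ hs, ← mul_assoc, ENNReal.coe_mul,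
          ENNReal.coe_rpow_of_nonneg _ hs]
        rfl

end WeightedGagliardo

section Exponents

/-- A differentiable function with the modulus of a given power. -/
theorem exists_differentiable_abs_eq_rpow {γ : ℝ} (hγ : 1 ≤ γ) :
    ∃ f : ℝ → ℝ, Differentiable ℝ f ∧ (∀ y, |f y| = |y| ^ γ) ∧
      ∀ y, |deriv f y| = γ * |y| ^ (γ - 1) := by
  rcases hγ.eq_or_lt with rfl | hγ
  · exact ⟨id, differentiable_id, fun y => by simp, fun y => by simp⟩
  · refine ⟨fun y => |y| ^ γ, fun y => (hasDerivAt_abs_rpow y hγ).differentiableAt,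
      fun y => abs_of_nonneg (by positivity), fun y => ?_⟩
    rw [(hasDerivAt_abs_rpow y hγ).deriv, abs_mul, abs_of_nonneg (by positivity), mul_assoc]
    congr 1
    rcases eq_or_ne y 0 with rfl | hy
    · simp [Real.zero_rpow (by linarith : γ - 1 ≠ 0)]
    · rw [← Real.rpow_add_one (abs_ne_zero.2 hy)]
      congr 1
      ring

theorem ENNReal.rpow_one_sub_le_of_le_mul_rpow {X A : ℝ≥0∞} {θ : ℝ} (hX : X ≠ ∞) (hθ : θ < 1)
    (h : X ≤ A * X ^ θ) : X ^ (1 - θ) ≤ A := by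
  rcases eq_or_ne X 0 with rfl | hX0
  · rw [ENNReal.zero_rpow_of_pos (by linarith)]
    exact zero_le
  · rw [ENNReal.rpow_sub _ _ hX0 hX, ENNReal.rpow_one]
    exact ENNReal.div_le_of_le_mul h

theorem lintegral_rpow_le_of_measure_univ_le {Ω : Type*} [MeasurableSpace Ω]
    {μ : Measure Ω} {f : Ω → ℝ}
    (hf : Measurable f) {a b : ℝ} (ha : 0 < a) (hab : a ≤ b) {M : NNReal} (hM : μ univ ≤ M) :
    (∫⁻ x, ‖f x‖ₑ ^ a ∂μ) ^ (1 / a) ≤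
      (∫⁻ x, ‖f x‖ₑ ^ b ∂μ) ^ (1 / b) * (M : ℝ≥0∞) ^ (1 / a - 1 / b) :=
  (eLpNorm'_le_eLpNorm'_mul_rpow_measure_univ ha hab hf.aestronglyMeasurable).trans
    (mul_le_mul_right (ENNReal.rpow_le_rpow hM
      (sub_nonneg.2 (one_div_le_one_div_of_le ha hab))) _)

variable {E : Type*} [NormedAddCommGroup E] [NormedSpace ℝ E] [MeasurableSpace E]

/-- The Sobolev inequality with exponent one for the measure `μ` on `O`. -/
def SobolevOneBound (μ : Measure E) (O : Set E) (s : ℝ) (K : NNReal) : Prop :=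
  ∀ v : E → ℝ, Measurable v → (∀ y ∈ O, DifferentiableAt ℝ v y) →
    ∫⁻ x, ‖v x‖ₑ ^ s ∂μ ≤ K * (∫⁻ x, (‖v x‖ₑ + ‖fderiv ℝ v x‖ₑ) ∂μ) ^ s

variable [BorelSpace E] {μ : Measure E} {O : Set E} {N : ℝ} {K : NNReal}

/-- Self-improvement of the exponent, for bounded functions. -/
theorem SobolevOneBound.lintegral_le_of_bounded (hN : 1 < N)
    (hK : SobolevOneBound μ O (N / (N - 1)) K) (hO : ∀ᵐ x ∂μ, x ∈ O) [IsFiniteMeasure μ] {r : ℝ}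
    (hr : 1 ≤ r) (hrN : r < N) {u : E → ℝ} (hum : Measurable u)
    (hu : ∀ y ∈ O, DifferentiableAt ℝ u y) {B : ℝ} (hB : ∀ x, |u x| ≤ B) :
    (∫⁻ x, ‖u x‖ₑ ^ (r * N / (N - r)) ∂μ) ^ ((N - r) / (r * N)) ≤
      (K : ℝ≥0∞) ^ ((N - 1) / N) * ENNReal.ofReal (r * (N - 1) / (N - r)) *
        (∫⁻ x, (‖u x‖ₑ + ‖fderiv ℝ u x‖ₑ) ^ r ∂μ) ^ (1 / r) := by
  have hN1 : 0 < N - 1 := by linarith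
  have hNr : 0 < N - r := by linarith
  have hN0 : 0 < N := by linarith
  have hr0 : 0 < r := by linarith
  set s := N / (N - 1)
  set γ := r * (N - 1) / (N - r)
  have hs : 0 < s := by positivity
  have hγ : 1 ≤ γ := by rw [le_div_iff₀ hNr]; nlinarith
  have hγs : γ * s = r * N / (N - r) := by simp only [γ, s]; field_simp
  have hγ1 : γ - 1 = N * (r - 1) / (N - r) := by simp only [γ]; field_simp; ring
  have hγ1' : 0 ≤ γ - 1 := by linarith
  have hgm : Measurable fun x => ‖u x‖ₑ + ‖fderiv ℝ u x‖ₑ :=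
    hum.enorm.add (measurable_fderiv ℝ u).enorm
  obtain ⟨f, hf, hfabs, hfderiv⟩ := exists_differentiable_abs_eq_rpow hγ
  have hfen : ∀ y, ‖f y‖ₑ = ‖y‖ₑ ^ γ := fun y => by
    rw [← Real.enorm_abs, hfabs, Real.enorm_rpow_of_nonneg (abs_nonneg _) (by linarith),
      Real.enorm_abs]
  have h1 := hK (fun x => f (u x)) (hf.continuous.measurable.comp hum)
    fun y hy => (hf _).comp y (hu y hy)
  set X := ∫⁻ x, ‖u x‖ₑ ^ (r * N / (N - r)) ∂μ
  have hXeq : ∫⁻ x, ‖f (u x)‖ₑ ^ s ∂μ = X := by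
    refine lintegral_congr fun x => ?_
    rw [hfen, ← ENNReal.rpow_mul, hγs]
  have hgrad : ∫⁻ x, (‖f (u x)‖ₑ + ‖fderiv ℝ (fun x => f (u x)) x‖ₑ) ∂μ ≤
      ENNReal.ofReal γ * ∫⁻ x, ‖u x‖ₑ ^ (γ - 1) * (‖u x‖ₑ + ‖fderiv ℝ u x‖ₑ) ∂μ := by
    have hm : Measurable fun x => ‖u x‖ₑ ^ (γ - 1) * (‖u x‖ₑ + ‖fderiv ℝ u x‖ₑ) :=
      (hum.enorm.pow_const _).mul hgm
    rw [← lintegral_const_mul _ hm]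
    refine lintegral_mono_ae (hO.mono fun x hx => ?_)
    have hfd : fderiv ℝ (fun x => f (u x)) x = deriv f (u x) • fderiv ℝ u x :=
      ((hf (u x)).hasDerivAt.comp_hasFDerivAt x (hu x hx).hasFDerivAt).fderiv
    have hd : ‖deriv f (u x)‖ₑ = ENNReal.ofReal γ * ‖u x‖ₑ ^ (γ - 1) := by
      rw [← Real.enorm_abs, hfderiv, enorm_mul, Real.enorm_rpow_of_nonneg (abs_nonneg _) hγ1',
        Real.enorm_abs, Real.enorm_of_nonneg (by linarith)]
    have hpow : ‖u x‖ₑ ^ γ = ‖u x‖ₑ ^ (γ - 1) * ‖u x‖ₑ := by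
      conv_lhs => rw [← sub_add_cancel γ 1]
      rw [ENNReal.rpow_add_of_nonneg _ _ hγ1' zero_le_one, ENNReal.rpow_one]
    rw [hfd, enorm_smul, hd, hfen, hpow, mul_add, mul_add, ← mul_assoc (ENNReal.ofReal γ)]
    gcongr ?_ + ?_
    · rw [mul_assoc]
      exact le_mul_of_one_le_left' (ENNReal.one_le_ofReal.2 hγ)
    · rw [mul_assoc]
  set Y := ∫⁻ x, (‖u x‖ₑ + ‖fderiv ℝ u x‖ₑ) ^ r ∂μ
  have hholder : ∫⁻ x, ‖u x‖ₑ ^ (γ - 1) * (‖u x‖ₑ + ‖fderiv ℝ u x‖ₑ) ∂μ ≤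
      X ^ (1 - 1 / r) * Y ^ (1 / r) := by
    rcases hr.eq_or_lt with rfl | hr1
    · have hγ0 : γ - 1 = 0 := by rw [hγ1]; simp
      simp [hγ0, Y]
    · have hconj := (Real.HolderConjugate.conjExponent hr1).symm
      refine (ENNReal.lintegral_mul_le_Lp_mul_Lq μ hconj
        (hum.enorm.pow_const (γ - 1)).aemeasurable hgm.aemeasurable).trans (le_of_eq ?_)
      have he1 : 1 / r.conjExponent = 1 - 1 / r := by
        rw [one_div, one_div, Real.conjExponent, inv_div]
        field_simp
      have he2 : (γ - 1) * r.conjExponent = r * N / (N - r) := by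
        have : r - 1 ≠ 0 := by linarith
        rw [hγ1, Real.conjExponent]
        field_simp
      rw [he1]
      congr 2
      refine lintegral_congr fun x => ?_
      rw [← ENNReal.rpow_mul, he2]
  have hθ : 1 - (1 - 1 / r) * s = (N - r) / (r * (N - 1)) := by
    simp only [s]; field_simp; ring
  have hXfin : X ≠ ∞ := by
    have hpos : 0 ≤ r * N / (N - r) := by positivity
    refine ne_top_of_le_ne_top ?_ (lintegral_mono fun x =>
      ENNReal.rpow_le_rpow (show ‖u x‖ₑ ≤ ENNReal.ofReal B from ?_) hpos)
    · rw [lintegral_const]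
      exact ENNReal.mul_ne_top (ENNReal.rpow_ne_top_of_nonneg hpos ENNReal.ofReal_ne_top)
        (measure_ne_top _ _)
    · rw [← ofReal_norm, Real.norm_eq_abs]
      exact ENNReal.ofReal_le_ofReal (hB x)
  have hmain : X ^ ((N - r) / (r * (N - 1))) ≤ K * (ENNReal.ofReal γ * Y ^ (1 / r)) ^ s := by
    rw [← hθ]
    refine ENNReal.rpow_one_sub_le_of_le_mul_rpow hXfin ?_ ?_
    · have : 0 < (N - r) / (r * (N - 1)) := by positivity
      linarith
    · calc X ≤ K * (ENNReal.ofReal γ * (X ^ (1 - 1 / r) * Y ^ (1 / r))) ^ s := by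
            rw [← hXeq]
            exact h1.trans (by gcongr; exact hXeq.symm ▸ hgrad.trans (by gcongr))
        _ = _ := by
            rw [ENNReal.rpow_mul, mul_left_comm (ENNReal.ofReal γ), mul_comm (X ^ _),
              ENNReal.mul_rpow_of_nonneg _ _ hs.le, mul_assoc]
  have hexp : (N - r) / (r * N) = (N - r) / (r * (N - 1)) * ((N - 1) / N) := by field_simp
  have hs' : s * ((N - 1) / N) = 1 := by simp only [s]; field_simp
  rw [hexp, ENNReal.rpow_mul]
  refine (ENNReal.rpow_le_rpow hmain (by positivity)).trans (le_of_eq ?_)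
  rw [ENNReal.mul_rpow_of_nonneg _ _ (by positivity), ← ENNReal.rpow_mul, hs', ENNReal.rpow_one,
    mul_assoc]

/-- Self-improvement of the exponent. -/
theorem SobolevOneBound.lintegral_le (hN : 1 < N)
    (hK : SobolevOneBound μ O (N / (N - 1)) K) (hO : ∀ᵐ x ∂μ, x ∈ O) [IsFiniteMeasure μ] {r : ℝ}
    (hr : 1 ≤ r) (hrN : r < N) {u : E → ℝ} (hum : Measurable u)
    (hu : ∀ y ∈ O, DifferentiableAt ℝ u y) :
    (∫⁻ x, ‖u x‖ₑ ^ (r * N / (N - r)) ∂μ) ^ ((N - r) / (r * N)) ≤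
      (K : ℝ≥0∞) ^ ((N - 1) / N) * ENNReal.ofReal (r * (N - 1) / (N - r)) *
        (∫⁻ x, (‖u x‖ₑ + ‖fderiv ℝ u x‖ₑ) ^ r ∂μ) ^ (1 / r) := by
  have hNr : 0 < N - r := by linarith
  have hN0 : 0 < N := by linarith
  have hr0 : 0 < r := by linarith
  set c : ℕ → ℝ := fun k => 1 / ((k : ℝ) + 1)
  have hc : ∀ k, 0 < c k := fun k => by positivity
  have hc1 : ∀ k, c k ≤ 1 := fun k => by
    rw [div_le_one (by positivity)]
    linarith [(Nat.cast_nonneg k : (0 : ℝ) ≤ k)]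
  have hc0 : Tendsto c atTop (𝓝 0) := tendsto_one_div_add_atTop_nhds_zero_nat
  set ψ : ℕ → ℝ → ℝ := fun k y => y / (1 + c k * y ^ 2)
  have hden : ∀ k y, 1 ≤ 1 + c k * y ^ 2 := fun k y => by
    have := mul_nonneg (hc k).le (sq_nonneg y)
    linarith
  have hderiv : ∀ k y, HasDerivAt (ψ k) ((1 - c k * y ^ 2) / (1 + c k * y ^ 2) ^ 2) y := by
    intro k y
    have h1 : HasDerivAt (fun y : ℝ => 1 + c k * y ^ 2) (c k * (2 * y)) y := by
      simpa using ((hasDerivAt_pow 2 y).const_mul (c k)).const_add 1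
    refine ((hasDerivAt_id y).div h1 (by linarith [hden k y])).congr_deriv ?_
    simp only [id]
    ring
  have hderiv_le : ∀ k y, |(1 - c k * y ^ 2) / (1 + c k * y ^ 2) ^ 2| ≤ 1 := by
    intro k y
    have h0 := mul_nonneg (hc k).le (sq_nonneg y)
    rw [abs_div, abs_of_nonneg (a := (1 + c k * y ^ 2) ^ 2) (sq_nonneg _),
      div_le_one (by positivity), abs_le]
    constructor <;> nlinarith
  have hψ_le : ∀ k y, |ψ k y| ≤ |y| := by
    intro k y
    have h0 := hden k y
    simp only [ψ]
    rw [abs_div, abs_of_nonneg (by linarith : 0 ≤ 1 + c k * y ^ 2)]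
    exact div_le_self (abs_nonneg y) h0
  have hψ_bdd : ∀ k y, |ψ k y| ≤ 1 / c k := by
    intro k y
    have h0 := hden k y
    simp only [ψ]
    rw [abs_div, abs_of_nonneg (by linarith : 0 ≤ 1 + c k * y ^ 2),
      div_le_div_iff₀ (by linarith) (hc k), one_mul]
    have h1 := mul_nonneg (hc k).le (sq_nonneg (|y| - 1))
    have h2 := mul_nonneg (hc k).le (abs_nonneg y)
    rw [← sq_abs y]
    nlinarith [hc1 k]
  have hψ_tendsto : ∀ y, Tendsto (fun k => ψ k y) atTop (𝓝 y) := by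
    intro y
    have h1 : Tendsto (fun k => 1 + c k * y ^ 2) atTop (𝓝 (1 + 0 * y ^ 2)) :=
      (hc0.mul_const _).const_add _
    have h2 := (tendsto_const_nhds (x := y)).div h1 (by simp)
    rw [zero_mul, add_zero, div_one] at h2
    exact h2
  have hψm : ∀ k, Measurable fun x => ψ k (u x) := fun k =>
    (continuous_iff_continuousAt.2 fun y => (hderiv k y).continuousAt).measurable.comp hum
  set Z := (K : ℝ≥0∞) ^ ((N - 1) / N) * ENNReal.ofReal (r * (N - 1) / (N - r)) *
        (∫⁻ x, (‖u x‖ₑ + ‖fderiv ℝ u x‖ₑ) ^ r ∂μ) ^ (1 / r)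
  have hpos : 0 < r * N / (N - r) := by positivity
  have hpos' : 0 < (N - r) / (r * N) := by positivity
  have hinv : (N - r) / (r * N) = (r * N / (N - r))⁻¹ := (inv_div _ _).symm
  have hbound : ∀ k, ∫⁻ x, ‖ψ k (u x)‖ₑ ^ (r * N / (N - r)) ∂μ ≤ Z ^ (r * N / (N - r)) := by
    intro k
    rw [← ENNReal.rpow_inv_le_iff hpos, ← hinv]
    refine (hK.lintegral_le_of_bounded hN hO hr hrN (hψm k)
      (fun y hy => (hderiv k _).differentiableAt.comp y (hu y hy)) (fun x => hψ_bdd k _)).trans ?_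
    refine mul_le_mul_right (ENNReal.rpow_le_rpow (lintegral_mono_ae (hO.mono fun x hx => ?_))
      (by positivity)) _
    have hfd : fderiv ℝ (fun x => ψ k (u x)) x = _ • fderiv ℝ u x :=
      ((hderiv k (u x)).comp_hasFDerivAt x (hu x hx).hasFDerivAt).fderiv
    refine ENNReal.rpow_le_rpow (add_le_add ?_ ?_) hr0.le
    · rw [enorm_le_iff_norm_le]
      exact hψ_le k (u x)
    · rw [hfd, enorm_le_iff_norm_le, norm_smul]
      exact mul_le_of_le_one_left (norm_nonneg _) (hderiv_le k (u x))
  rw [hinv, ENNReal.rpow_inv_le_iff hpos]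
  calc ∫⁻ x, ‖u x‖ₑ ^ (r * N / (N - r)) ∂μ
      = ∫⁻ x, liminf (fun k => ‖ψ k (u x)‖ₑ ^ (r * N / (N - r))) atTop ∂μ := by
        refine lintegral_congr fun x => (Tendsto.liminf_eq ?_).symm
        exact ((ENNReal.continuous_rpow_const.comp continuous_enorm).tendsto _).comp
          (hψ_tendsto (u x))
    _ ≤ liminf (fun k => ∫⁻ x, ‖ψ k (u x)‖ₑ ^ (r * N / (N - r)) ∂μ) atTop :=
        lintegral_liminf_le fun k => (hψm k).enorm.pow_const _
    _ ≤ Z ^ (r * N / (N - r)) := by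
        refine (liminf_le_liminf (Eventually.of_forall hbound)).trans ?_
        rw [liminf_const]

/-- The full range of Sobolev inequalities follows from the one with exponent one, with a
constant depending on the measure only through its mass and the given constant. -/
theorem exists_sobolev_bound_of_sobolevOneBound (hN : 1 < N) (K M : NNReal) {p q : ℝ}
    (hp : 1 ≤ p) (hq : 1 ≤ q) (hpq : p < N → q ≤ p * N / (N - p)) :
    ∃ C : NNReal, ∀ (μ : Measure E) (O : Set E), SobolevOneBound μ O (N / (N - 1)) K →
      μ univ ≤ M → (∀ᵐ x ∂μ, x ∈ O) → ∀ u : E → ℝ, Measurable u →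
      (∀ y ∈ O, DifferentiableAt ℝ u y) →
      (∫⁻ x, ‖u x‖ₑ ^ q ∂μ) ^ (1 / q) ≤
        C * (∫⁻ x, (‖u x‖ₑ + ‖fderiv ℝ u x‖ₑ) ^ p ∂μ) ^ (1 / p) := by
  obtain ⟨r, hr, hrN, hrp, hqr⟩ : ∃ r, 1 ≤ r ∧ r < N ∧ r ≤ p ∧ q ≤ r * N / (N - r) := by
    by_cases h : p < N
    · exact ⟨p, hp, h, le_rfl, hpq h⟩
    · have hlt : max 1 (q * N / (N + q)) < N := by
        refine max_lt hN ?_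
        rw [div_lt_iff₀ (by linarith)]
        nlinarith
      refine ⟨max 1 (q * N / (N + q)), le_max_left _ _, hlt, hlt.le.trans (not_lt.1 h), ?_⟩
      have h1 : q * N / (N + q) ≤ max 1 (q * N / (N + q)) := le_max_right _ _
      rw [div_le_iff₀ (by linarith)] at h1
      rw [le_div_iff₀ (by linarith)]
      linarith
  have hNr : 0 < N - r := by linarith
  have hr0 : 0 < r := by linarith
  have hN0 : 0 < N := by linarith
  set b := r * N / (N - r)
  set A : ℝ≥0∞ := (K : ℝ≥0∞) ^ ((N - 1) / N) * ENNReal.ofReal (r * (N - 1) / (N - r))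
  set C : ℝ≥0∞ := A * (M : ℝ≥0∞) ^ (1 / r - 1 / p) * (M : ℝ≥0∞) ^ (1 / q - 1 / b)
  have hexp1 : 0 ≤ 1 / r - 1 / p := sub_nonneg.2 (one_div_le_one_div_of_le hr0 hrp)
  have hexp2 : 0 ≤ 1 / q - 1 / b := sub_nonneg.2 (one_div_le_one_div_of_le (by linarith) hqr)
  have hC : C ≠ ∞ := by
    refine ENNReal.mul_ne_top (ENNReal.mul_ne_top (ENNReal.mul_ne_top ?_ ENNReal.ofReal_ne_top) ?_)
      ?_
    · exact ENNReal.rpow_ne_top_of_nonneg (div_nonneg (by linarith) hN0.le) ENNReal.coe_ne_top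
    · exact ENNReal.rpow_ne_top_of_nonneg hexp1 ENNReal.coe_ne_top
    · exact ENNReal.rpow_ne_top_of_nonneg hexp2 ENNReal.coe_ne_top
  refine ⟨C.toNNReal, fun μ O hK hM hO u hum hu => ?_⟩
  have : IsFiniteMeasure μ := ⟨hM.trans_lt ENNReal.coe_lt_top⟩
  rw [ENNReal.coe_toNNReal hC]
  have h1 := hK.lintegral_le hN hO hr hrN hum hu
  have hb : (N - r) / (r * N) = 1 / b := (one_div_div _ _).symm
  rw [hb] at h1
  have h2 := lintegral_rpow_le_of_measure_univ_le hum (by linarith) hqr hM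
  have h3 := lintegral_rpow_le_of_measure_univ_le (μ := μ)
    (hum.norm.add (measurable_fderiv ℝ u).norm) hr0 hrp hM
  have hsum : ∀ x, ‖‖u x‖ + ‖fderiv ℝ u x‖‖ₑ = ‖u x‖ₑ + ‖fderiv ℝ u x‖ₑ := fun x => by
    rw [Real.enorm_of_nonneg (by positivity), ENNReal.ofReal_add (norm_nonneg _) (norm_nonneg _),
      ofReal_norm, ofReal_norm]
  simp only [Pi.add_apply, hsum] at h3
  calc _ ≤ _ := h2
    _ ≤ A * ((∫⁻ x, (‖u x‖ₑ + ‖fderiv ℝ u x‖ₑ) ^ p ∂μ) ^ (1 / p) *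
          (M : ℝ≥0∞) ^ (1 / r - 1 / p)) * (M : ℝ≥0∞) ^ (1 / q - 1 / b) := by
        gcongr
        exact h1.trans (by gcongr)
    _ = _ := by ring

end Exponents

section Embedding

/-- The phase-field weight is comparable to `truncDist d ε ^ α` on `{d < ε}`. -/
theorem phaseField_comparable {E : Type*} {d : E → ℝ} {S : ℝ → ℝ} {ζ₁ ζ₂ α ε : ℝ} (hζ₁ : 0 < ζ₁)
    (hζ₂ : 0 < ζ₂) (hα : 0 < α) (hS_sign : ∀ t : ℝ, 1 ≤ |t| → S t = t / |t|)
    (hS2 : ∀ t ∈ Ioo (0 : ℝ) 2,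
      ζ₁ * t ^ α ≤ (1 + S (t - 1)) / 2 ∧ (1 + S (t - 1)) / 2 ≤ ζ₂ * t ^ α)
    (hε : 0 < ε) {x : E} (hx : d x < ε) :
    min ζ₁ 1 * truncDist d ε x ^ α ≤ (1 + S (-d x / ε)) / 2 ∧
      (1 + S (-d x / ε)) / 2 ≤ max (ζ₂ * 2 ^ α) 1 * truncDist d ε x ^ α := by
  obtain ⟨t, ht⟩ : ∃ t, t = 1 - d x / ε := ⟨_, rfl⟩
  have ht' : -d x / ε = t - 1 := by rw [ht]; ring
  have ht0 : 0 < t := by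
    rw [ht, sub_pos, div_lt_one hε]
    exact hx
  have h2 : 1 ≤ (2 : ℝ) ^ α := Real.one_le_rpow one_le_two hα.le
  have hW : truncDist d ε x = max 0 (min 1 t) := by rw [ht]; rfl
  rw [ht', hW, max_eq_right (le_min zero_le_one ht0.le)]
  rcases le_or_gt 2 t with h | h
  · have h1 : 0 < t - 1 := by linarith
    rw [min_eq_left (by linarith : (1 : ℝ) ≤ t), Real.one_rpow,
      hS_sign _ (by rw [abs_of_pos h1]; linarith), abs_of_pos h1, div_self h1.ne']
    norm_num
  obtain ⟨hl, hu⟩ := hS2 t ⟨ht0, h⟩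
  have hle : min 1 t ^ α ≤ t ^ α :=
    Real.rpow_le_rpow (le_min zero_le_one ht0.le) (min_le_right _ _) hα.le
  refine ⟨le_trans ?_ hl, hu.trans ?_⟩
  · exact mul_le_mul (min_le_left _ _) hle
      (Real.rpow_nonneg (le_min zero_le_one ht0.le) _) hζ₁.le
  · have hge : t ^ α ≤ 2 ^ α * min 1 t ^ α := by
      rw [← Real.mul_rpow zero_le_two (le_min zero_le_one ht0.le)]
      refine Real.rpow_le_rpow ht0.le ?_ hα.le
      rw [mul_min_of_nonneg _ _ zero_le_two]
      exact le_min (by linarith) (by linarith)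
    calc ζ₂ * t ^ α ≤ ζ₂ * 2 ^ α * min 1 t ^ α := by
          rw [mul_assoc]
          gcongr
      _ ≤ _ := by
          gcongr
          exact le_max_left _ _

variable {n : ℕ} {U : Set (EuclideanSpace ℝ (Fin n))} {w : EuclideanSpace ℝ (Fin n) → ℝ}

theorem lintegral_wMeas (hw : Measurable w) {f : EuclideanSpace ℝ (Fin n) → ℝ}
    (hf : Measurable f) (hf0 : ∀ x, 0 ≤ f x) :
    ∫⁻ x, ENNReal.ofReal (f x) ∂wMeas U w = ∫⁻ x in U, ENNReal.ofReal (f x * w x) := by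
  rw [wMeas, lintegral_withDensity_eq_lintegral_mul _ hw.ennreal_ofReal hf.ennreal_ofReal]
  refine lintegral_congr fun x => ?_
  rw [Pi.mul_apply, mul_comm, ENNReal.ofReal_mul (hf0 x)]

theorem ae_mem_wMeas (hU : MeasurableSet U) : ∀ᵐ x ∂wMeas U w, x ∈ U :=
  (withDensity_absolutelyContinuous _ _).ae_le (ae_restrict_mem hU)

theorem wMeas_univ_le (hw : ∀ x, w x ≤ 1) : wMeas U w univ ≤ volume U := by
  rw [wMeas, withDensity_apply _ MeasurableSet.univ, Measure.restrict_univ]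
  calc ∫⁻ x in U, ENNReal.ofReal (w x) ≤ ∫⁻ _ in U, 1 :=
        lintegral_mono fun x => ENNReal.ofReal_le_one.2 (hw x)
    _ = volume U := by simp

theorem enorm_rpow_eq_ofReal_abs_rpow (a : ℝ) {s : ℝ} (hs : 0 ≤ s) :
    ‖a‖ₑ ^ s = ENNReal.ofReal (|a| ^ s) := by
  rw [Real.enorm_eq_ofReal_abs, ENNReal.ofReal_rpow_of_nonneg (abs_nonneg _) hs]

theorem lintegral_setOf_mono_weight {d : EuclideanSpace ℝ (Fin n) → ℝ} (hd : Measurable d)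
    {ε c : ℝ} (hc : 0 ≤ c) {f w₁ w₂ : EuclideanSpace ℝ (Fin n) → ℝ} (hf : ∀ x, 0 ≤ f x)
    (hw : ∀ x, d x < ε → w₁ x ≤ c * w₂ x) :
    ∫⁻ x in {x | d x < ε}, ENNReal.ofReal (f x * w₁ x) ≤
      ENNReal.ofReal c * ∫⁻ x in {x | d x < ε}, ENNReal.ofReal (f x * w₂ x) := by
  rw [← lintegral_const_mul' _ _ ENNReal.ofReal_ne_top]
  refine setLIntegral_mono' (measurableSet_lt hd measurable_const) fun x hx => ?_
  rw [← ENNReal.ofReal_mul hc]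
  refine ENNReal.ofReal_le_ofReal ?_
  calc f x * w₁ x ≤ f x * (c * w₂ x) := mul_le_mul_of_nonneg_left (hw x hx) (hf x)
    _ = c * (f x * w₂ x) := by ring

end Embedding

/-- Weighted Sobolev embedding for the power weight, uniformly in `ε`. -/
theorem exists_weighted_sobolev_truncDist {n : ℕ} (hn : 2 ≤ n)
    {d : EuclideanSpace ℝ (Fin n) → ℝ} (hd : LipschitzWith 1 d) {α : ℝ} (hα : 0 < α)
    {ε₀ : ℝ} (hε₀ : 0 < ε₀) (hbdd : Bornology.IsBounded {y | d y ≤ ε₀})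
    (hdesc : ∀ x, 0 ≤ d x → d x ≤ ε₀ → HasDescentDirection d x) {p q : ℝ} (hp : 1 ≤ p)
    (hq : 1 ≤ q) (hpq : p < n + α → q ≤ p * (n + α) / (n + α - p)) :
    ∃ C : NNReal, ∀ ε ∈ Ioo 0 ε₀, ∀ u : EuclideanSpace ℝ (Fin n) → ℝ, Measurable u →
      (∀ y, d y < ε → DifferentiableAt ℝ u y) →
      (∫⁻ x in {x | d x < ε}, ENNReal.ofReal (|u x| ^ q * truncDist d ε x ^ α)) ^ (1 / q) ≤
        C * (∫⁻ x in {x | d x < ε}, ENNReal.ofReal ((|u x| ^ p + ‖fderiv ℝ u x‖ ^ p) *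
          truncDist d ε x ^ α)) ^ (1 / p) := by
  have hn' : (2 : ℝ) ≤ n := by exact_mod_cast hn
  have hp0 : 0 < p := by linarith
  obtain ⟨K, hK⟩ := exists_lintegral_rpow_weight_le hn hd hα hε₀ hbdd hdesc
  have hfin : volume {y | d y ≤ ε₀} ≠ ∞ := hbdd.measure_lt_top.ne
  obtain ⟨C, hC⟩ := exists_sobolev_bound_of_sobolevOneBound
    (E := EuclideanSpace ℝ (Fin n)) (N := n + α) (by linarith) K
    (volume {y | d y ≤ ε₀}).toNNReal hp hq hpq
  have hdm := hd.continuous.measurable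
  refine ⟨C * (2 ^ (p - 1)) ^ (1 / p), fun ε hε u hum hu => ?_⟩
  set w : EuclideanSpace ℝ (Fin n) → ℝ := fun x => truncDist d ε x ^ α
  have hw : Measurable w := (measurable_truncDist hdm).pow_const α
  have hs : 0 ≤ (n + α) / (n + α - 1) := div_nonneg (by linarith) (by linarith)
  have hone : SobolevOneBound (wMeas {x | d x < ε} w) {x | d x < ε}
      ((n + α) / (n + α - 1)) K := by
    intro v hvm hv
    have hf : Measurable fun x => ‖fderiv ℝ v x‖ + |v x| :=
      (measurable_fderiv ℝ v).norm.add hvm.abs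
    have h1 : ∀ x, ‖v x‖ₑ + ‖fderiv ℝ v x‖ₑ = ENNReal.ofReal (‖fderiv ℝ v x‖ + |v x|) := fun x => by
      rw [ENNReal.ofReal_add (norm_nonneg _) (abs_nonneg _), ← Real.enorm_eq_ofReal_abs,
        ofReal_norm, add_comm]
    simp only [enorm_rpow_eq_ofReal_abs_rpow _ hs, h1]
    rw [lintegral_wMeas hw (hvm.abs.pow_const _) fun x => by positivity,
      lintegral_wMeas hw hf fun x => by positivity]
    exact hK ε hε v hvm hv
  have hM : wMeas {x | d x < ε} w univ ≤ ((volume {y | d y ≤ ε₀}).toNNReal : ℝ≥0∞) := by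
    rw [ENNReal.coe_toNNReal hfin]
    refine (wMeas_univ_le fun x =>
      Real.rpow_le_one truncDist_nonneg truncDist_le_one hα.le).trans (measure_mono ?_)
    exact fun x hx => (le_of_lt hx).trans hε.2.le
  have key := hC _ _ hone hM (ae_mem_wMeas (measurableSet_lt hdm measurable_const)) u hum hu
  have hfm : Measurable fun x => |u x| ^ p + ‖fderiv ℝ u x‖ ^ p :=
    (hum.abs.pow_const _).add ((measurable_fderiv ℝ u).norm.pow_const _)
  simp only [enorm_rpow_eq_ofReal_abs_rpow _ (by linarith : 0 ≤ q)] at key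
  rw [lintegral_wMeas hw (hum.abs.pow_const _) fun x => by positivity] at key
  refine key.trans ?_
  rw [ENNReal.coe_mul, mul_assoc]
  gcongr
  rw [ENNReal.coe_rpow_of_nonneg _ (by positivity),
    ← ENNReal.mul_rpow_of_nonneg _ _ (by positivity),
    ← lintegral_wMeas hw hfm fun x => by positivity,
    ← lintegral_const_mul _ hfm.ennreal_ofReal]
  gcongr with x
  rw [ENNReal.ofReal_add (by positivity) (by positivity), ← enorm_rpow_eq_ofReal_abs_rpow _ hp0.le,
    ← ENNReal.ofReal_rpow_of_nonneg (norm_nonneg _) hp0.le, ofReal_norm,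
    ENNReal.coe_rpow_of_nonneg _ (by linarith)]
  exact ENNReal.rpow_add_le_mul_rpow_add_rpow _ _ hp

/-- Weighted Sobolev embedding `W^{1,p}(D_ε;ω^ε) ↪ L^q(D_ε;ω^ε)` for
`1 ≤ q ≤ p*_α` (`q < ∞`), with embedding constant independent of `ε`. -/
theorem weighted_sobolev_embedding
    (n : ℕ) (hn : 2 ≤ n)
    (D : Set (EuclideanSpace ℝ (Fin n)))
    (hD_open : IsOpen D) (hD_bdd : Bornology.IsBounded D) (hD_ne : D.Nonempty)
    (dD : EuclideanSpace ℝ (Fin n) → ℝ)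
    (hdD : ∀ x, dD x = Metric.infDist x D - Metric.infDist x Dᶜ)
    (Dt : ℝ → Set (EuclideanSpace ℝ (Fin n)))
    (hDt : ∀ t, Dt t = {x | dD x < t})
    (Γ : ℝ → Set (EuclideanSpace ℝ (Fin n)))
    (hΓ : ∀ ε : ℝ, Γ ε = Dt ε \ closure (Dt (-ε)))
    (ε₀ : ℝ) (hε₀ : 0 < ε₀)
    (hproj : ∀ z ∈ Γ (2 * ε₀), ∃! y, y ∈ frontier D ∧ dist z y = Metric.infDist z (frontier D))
    (hC11 : ∃ U : Set (EuclideanSpace ℝ (Fin n)), IsOpen U ∧ frontier D ⊆ U ∧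
      ContDiffOn ℝ 1 dD U ∧ ∃ L : NNReal, LipschitzOnWith L (fun x => fderiv ℝ dD x) U)
    (S : ℝ → ℝ) (ζ₁ ζ₂ α : ℝ) (hζ₁ : 0 < ζ₁) (hζ₂ : 0 < ζ₂) (hα : 0 < α)
    (hS_lip : ∃ L : NNReal, LipschitzWith L S)
    (hS_sign : ∀ t : ℝ, 1 ≤ |t| → S t = t / |t|)
    (hS_pos : ∀ t : ℝ, |t| < 1 → 0 < deriv S t)
    (hS_odd : ∀ t : ℝ, S (-t) = -S t)
    (hS2 : ∀ t ∈ Set.Ioo (0:ℝ) 2,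
      ζ₁ * t ^ α ≤ (1 + S (t - 1)) / 2 ∧ (1 + S (t - 1)) / 2 ≤ ζ₂ * t ^ α)
    (ω : ℝ → EuclideanSpace ℝ (Fin n) → ℝ)
    (hω : ∀ ε : ℝ, 0 < ε → ∀ x, ω ε x = (1 + S (-(dD x) / ε)) / 2)
 :
    ∀ p q : ℝ, 1 ≤ p → 1 ≤ q →
      (p < (n : ℝ) + α → q ≤ p * ((n : ℝ) + α) / ((n : ℝ) + α - p)) →
      ∃ C : ℝ, 0 < C ∧ ∀ ε ∈ Set.Ioo (0:ℝ) ε₀,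
        ∀ u : EuclideanSpace ℝ (Fin n) → ℝ, Measurable u →
          (∀ x ∈ Dt ε, DifferentiableAt ℝ u x) →
          (∫⁻ x in Dt ε, ENNReal.ofReal (|u x| ^ q * ω ε x)) ^ (1 / q) ≤
            ENNReal.ofReal C *
              (∫⁻ x in Dt ε,
                ENNReal.ofReal ((|u x| ^ p + ‖fderiv ℝ u x‖ ^ p) * ω ε x)) ^ (1 / p) := by
  intro p q hp hq hpq
  obtain ⟨U, hU, hDU, hC1, -⟩ := hC11
  obtain rfl : Dt = fun t => {x | dD x < t} := funext hDt
  have : NeZero n := ⟨by lia⟩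
  have hlip := lipschitzWith_orientedDist hdD
  have hdm := hlip.continuous.measurable
  obtain ⟨C, hC⟩ := exists_weighted_sobolev_truncDist hn hlip hα hε₀
    (isBounded_sublevel_orientedDist hD_bdd hD_ne hdD ε₀)
    (fun x h0 hx => hasDescentDirection_orientedDist hD_open hD_bdd hD_ne hdD hU hDU hC1
      (δ := 2 * ε₀) (fun z hz => hproj z (by rwa [hΓ])) h0 (by linarith)) hp hq hpq
  set a := min ζ₁ 1
  set b := max (ζ₂ * 2 ^ α) 1
  have ha : 0 < a := lt_min hζ₁ one_pos
  have hb : 0 < b := one_pos.trans_le (le_max_right _ _)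
  have hq0 : 0 < q := by linarith
  have hp0 : 0 < p := by linarith
  refine ⟨b ^ (1 / q) * C * a⁻¹ ^ (1 / p) + 1, by positivity, fun ε hε u hum hu => ?_⟩
  have hcmp : ∀ x, dD x < ε → a * truncDist dD ε x ^ α ≤ ω ε x ∧
      ω ε x ≤ b * truncDist dD ε x ^ α := fun x hx => by
    rw [hω ε hε.1]
    exact phaseField_comparable hζ₁ hζ₂ hα hS_sign hS2 hε.1 hx
  have hup := lintegral_setOf_mono_weight hdm (f := fun x => |u x| ^ q) hb.le
    (fun x => by positivity) fun x hx => (hcmp x hx).2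
  have hlo := lintegral_setOf_mono_weight hdm
    (f := fun x => |u x| ^ p + ‖fderiv ℝ u x‖ ^ p) (inv_pos.2 ha).le
    (fun x => by positivity) fun x hx => (le_inv_mul_iff₀ ha).2 (hcmp x hx).1
  calc _ ≤ (ENNReal.ofReal b * ∫⁻ x in {x | dD x < ε},
          ENNReal.ofReal (|u x| ^ q * truncDist dD ε x ^ α)) ^ (1 / q) :=
        ENNReal.rpow_le_rpow hup (by positivity)
    _ ≤ ENNReal.ofReal b ^ (1 / q) * (C * (∫⁻ x in {x | dD x < ε},
          ENNReal.ofReal ((|u x| ^ p + ‖fderiv ℝ u x‖ ^ p) *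
            truncDist dD ε x ^ α)) ^ (1 / p)) := by
        rw [ENNReal.mul_rpow_of_nonneg _ _ (by positivity)]
        gcongr
        exact hC ε hε u hum hu
    _ ≤ ENNReal.ofReal b ^ (1 / q) * (C * (ENNReal.ofReal a⁻¹ * ∫⁻ x in {x | dD x < ε},
          ENNReal.ofReal ((|u x| ^ p + ‖fderiv ℝ u x‖ ^ p) * ω ε x)) ^ (1 / p)) := by
        gcongr
    _ = ENNReal.ofReal (b ^ (1 / q) * C * a⁻¹ ^ (1 / p)) * (∫⁻ x in {x | dD x < ε},
          ENNReal.ofReal ((|u x| ^ p + ‖fderiv ℝ u x‖ ^ p) * ω ε x)) ^ (1 / p) := by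
        rw [ENNReal.mul_rpow_of_nonneg _ _ (by positivity), ENNReal.ofReal_mul (by positivity),
          ENNReal.ofReal_mul (by positivity), ENNReal.ofReal_rpow_of_nonneg hb.le (by positivity),
          ENNReal.ofReal_rpow_of_nonneg (by positivity) (by positivity), ENNReal.ofReal_coe_nnreal]
        ring
    _ ≤ _ := by
        gcongr
        linarith
end
end

section
/- Let ε > 0, α > 0 and let 1 ≤ q < ∞ satisfy n + α ≥ (n + α − 1)q. Setting δ(x) = dist(x, ∂D_ε), there exists a constant C > 0 independent of ε such that for every u ∈ W^{1,1}(D_ε; δ^α): ‖u‖_{L^q(D_ε∖D; δ^α)} ≤ C ( ‖u‖_{L^1(Γ_ε; δ^{α−1})} + ‖∇u‖_{L^1(Γ_ε; δ^α)} ). -/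
open MeasureTheory ENNReal Set Filter Topology
open scoped RealInnerProductSpace

noncomputable section

/-- The distance to the frontier of a set is at most the distance to any point outside it. -/
theorem infDist_frontier_le_dist {E : Type*} [NormedAddCommGroup E] [NormedSpace ℝ E]
    [FiniteDimensional ℝ E] {s : Set E} {x z : E} (hx : x ∈ s) (hz : z ∉ s) :
    Metric.infDist x (frontier s) ≤ dist x z := by
  obtain ⟨y, hy, hxy⟩ := exists_mem_frontier_infDist_compl_eq_dist hx
    (fun h => hz (h ▸ mem_univ z))
  calc Metric.infDist x (frontier s) ≤ dist x y := Metric.infDist_le_dist_of_mem hy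
    _ = Metric.infDist x sᶜ := hxy.symm
    _ ≤ dist x z := Metric.infDist_le_dist_of_mem hz

theorem enorm_mul_le_lintegral_add_lintegral_deriv {g g' : ℝ → ℝ} {l : ℝ}
    (hg : ∀ t ∈ Icc 0 l, HasDerivAt g (g' t) t) (hg' : Measurable g') :
    ‖g 0‖ₑ * ENNReal.ofReal l ≤
      (∫⁻ t in Icc 0 l, ‖g t‖ₑ) + ENNReal.ofReal l * ∫⁻ t in Icc 0 l, ‖g' t‖ₑ := by
  have key : ∀ s ∈ Icc 0 l, ‖g 0‖ₑ ≤ ‖g s‖ₑ + ∫⁻ t in Icc 0 l, ‖g' t‖ₑ := by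
    intro s hs
    by_cases hfin : (∫⁻ t in Icc 0 l, ‖g' t‖ₑ) = ⊤
    · simp [hfin]
    have hint : IntegrableOn g' (Icc 0 l) :=
      ⟨hg'.aestronglyMeasurable, lt_top_iff_ne_top.2 hfin⟩
    have hsub : Ioc 0 s ⊆ Icc 0 l := fun t ht => ⟨ht.1.le, ht.2.trans hs.2⟩
    have hftc : ∫ t in (0 : ℝ)..s, g' t = g s - g 0 := by
      apply intervalIntegral.integral_eq_sub_of_hasDerivAt
      · intro t ht
        rw [uIcc_of_le hs.1] at ht
        exact hg t ⟨ht.1, ht.2.trans hs.2⟩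
      · rw [intervalIntegrable_iff_integrableOn_Ioc_of_le hs.1]
        exact hint.mono_set hsub
    rw [intervalIntegral.integral_of_le hs.1] at hftc
    calc ‖g 0‖ₑ = ‖g s - (g s - g 0)‖ₑ := by congr 1; ring
      _ ≤ ‖g s‖ₑ + ‖g s - g 0‖ₑ := enorm_sub_le
      _ ≤ ‖g s‖ₑ + ∫⁻ t in Icc 0 l, ‖g' t‖ₑ := by
        gcongr
        rw [← hftc]
        exact (enorm_integral_le_lintegral_enorm _).trans (lintegral_mono_set hsub)
  have hcont : ContinuousOn g (Icc 0 l) := fun t ht => (hg t ht).continuousAt.continuousWithinAt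
  calc ‖g 0‖ₑ * ENNReal.ofReal l = ∫⁻ _ in Icc 0 l, ‖g 0‖ₑ := by simp
    _ ≤ ∫⁻ s in Icc 0 l, (‖g s‖ₑ + ∫⁻ t in Icc 0 l, ‖g' t‖ₑ) :=
        setLIntegral_mono' measurableSet_Icc key
    _ = _ := by
        rw [lintegral_add_right _ measurable_const]
        simp [mul_comm]

theorem rpow_le_two_rpow_mul {a b β : ℝ} {M : ℝ} (ha : 0 < a) (hab : a ≤ 2 * b)
    (hba : b ≤ 2 * a) (hM : |β| ≤ M) : a ^ β ≤ 2 ^ M * b ^ β := by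
  have hb : 0 < b := by linarith
  have h1 : (2 : ℝ) ^ |β| ≤ 2 ^ M := Real.rpow_le_rpow_of_exponent_le (by norm_num) hM
  refine le_trans ?_ (mul_le_mul_of_nonneg_right h1 (Real.rpow_nonneg hb.le _))
  rcases le_total 0 β with h | h
  · rw [abs_of_nonneg h, ← Real.mul_rpow (by norm_num) hb.le]
    exact Real.rpow_le_rpow ha.le hab h
  · rw [abs_of_nonpos h, Real.rpow_neg (by norm_num), ← Real.inv_rpow (by norm_num),
      ← Real.mul_rpow (by norm_num) hb.le]
    exact Real.rpow_le_rpow_of_nonpos (by positivity) (by linarith) h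

/-- A weighted one-dimensional bound: the value of `u` at a point is controlled by averages of
`u` and its gradient along a segment of length comparable to the weight function. -/
theorem enorm_mul_rpow_le_lintegral_line {E : Type*} [NormedAddCommGroup E] [NormedSpace ℝ E]
    [MeasurableSpace E] [BorelSpace E] {δ : E → ℝ} (hδ : LipschitzWith 1 δ)
    {u : E → ℝ} {G : Set E} {x e : E} (he : ‖e‖ = 1) {κ α : ℝ} (hα : 0 < α) (hκ : 0 < κ)
    (hκ' : κ ≤ 1 / 2) (hx : 0 < δ x)
    (hG : ∀ t ∈ Icc 0 (κ * δ x), x + t • e ∈ G ∧ DifferentiableAt ℝ u (x + t • e)) :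
    ‖u x‖ₑ * ENNReal.ofReal (δ x ^ α) ≤ ENNReal.ofReal (κ⁻¹ * 2 ^ (α + 1)) *
      ∫⁻ t : ℝ, G.indicator (fun y => ENNReal.ofReal (|u y| * δ y ^ (α - 1)) +
        ENNReal.ofReal (‖fderiv ℝ u y‖ * δ y ^ α)) (x + t • e) := by
  set d := δ x with hd
  set l := κ * d with hl
  have hl0 : 0 < l := by positivity
  have hγ : ∀ t : ℝ, HasDerivAt (fun t : ℝ => x + t • e) e t := fun t => by
    simpa using ((hasDerivAt_id t).smul_const e).const_add x
  have hderiv : ∀ t ∈ Icc 0 l, HasDerivAt (fun t : ℝ => u (x + t • e))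
      (deriv (fun t : ℝ => u (x + t • e)) t) t := fun t ht =>
    ((hG t ht).2.hasFDerivAt.comp_hasDerivAt t (hγ t)).differentiableAt.hasDerivAt
  have hbound : ∀ t ∈ Icc 0 l, ‖deriv (fun t : ℝ => u (x + t • e)) t‖ ≤
      ‖fderiv ℝ u (x + t • e)‖ := fun t ht => by
    have h := ((hG t ht).2.hasFDerivAt.comp_hasDerivAt t (hγ t)).deriv
    simp only [Function.comp_def] at h
    rw [h]
    simpa [he] using (fderiv ℝ u (x + t • e)).le_opNorm e
  have hline := enorm_mul_le_lintegral_add_lintegral_deriv hderiv (measurable_deriv _)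
  simp only [zero_smul, add_zero] at hline
  have hδt : ∀ t ∈ Icc 0 l, d ≤ 2 * δ (x + t • e) ∧ δ (x + t • e) ≤ 2 * d := fun t ht => by
    have h := hδ.dist_le_mul (x + t • e) x
    rw [Real.dist_eq] at h
    simp only [NNReal.coe_one, one_mul, dist_self_add_left, norm_smul, he, mul_one,
      Real.norm_eq_abs, abs_of_nonneg ht.1] at h
    have h2 : t ≤ 1 / 2 * d := ht.2.trans (mul_le_mul_of_nonneg_right hκ' hx.le)
    have := abs_le.1 h
    constructor <;> linarith
  set K := κ⁻¹ * (2 : ℝ) ^ (α + 1) with hK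
  have h2pos : (0 : ℝ) < 2 ^ (α + 1) := by positivity
  have hK0 : 0 ≤ K := by positivity
  have hdl : d ^ α / l = κ⁻¹ * d ^ (α - 1) := by
    rw [hl, Real.rpow_sub_one hx.ne']; field_simp
  have hcan : ENNReal.ofReal l * ENNReal.ofReal (d ^ α / l) = ENNReal.ofReal (d ^ α) := by
    rw [← ENNReal.ofReal_mul hl0.le]; congr 1; field_simp
  have hmeas : Measurable fun t : ℝ => ‖deriv (fun t : ℝ => u (x + t • e)) t‖ₑ :=
    (measurable_deriv _).enorm
  calc ‖u x‖ₑ * ENNReal.ofReal (d ^ α)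
      = (‖u x‖ₑ * ENNReal.ofReal l) * ENNReal.ofReal (d ^ α / l) := by rw [mul_assoc, hcan]
    _ ≤ ((∫⁻ t in Icc 0 l, ‖u (x + t • e)‖ₑ) + ENNReal.ofReal l *
          ∫⁻ t in Icc 0 l, ‖deriv (fun t : ℝ => u (x + t • e)) t‖ₑ) *
          ENNReal.ofReal (d ^ α / l) := by gcongr
    _ = ∫⁻ t in Icc 0 l, (ENNReal.ofReal (d ^ α / l) * ‖u (x + t • e)‖ₑ +
          ENNReal.ofReal (d ^ α) * ‖deriv (fun t : ℝ => u (x + t • e)) t‖ₑ) := by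
        rw [lintegral_add_right _ (hmeas.const_mul _), lintegral_const_mul _ hmeas,
          lintegral_const_mul' _ _ ENNReal.ofReal_ne_top, add_mul, ← hcan]
        ring
    _ ≤ ∫⁻ t in Icc 0 l, ENNReal.ofReal K *
          G.indicator (fun y => ENNReal.ofReal (|u y| * δ y ^ (α - 1)) +
        ENNReal.ofReal (‖fderiv ℝ u y‖ * δ y ^ α)) (x + t • e) := by
        refine setLIntegral_mono' measurableSet_Icc fun t ht => ?_
        rw [indicator_of_mem (hG t ht).1, mul_add]
        have hδ0 : 0 < δ (x + t • e) := by linarith [(hδt t ht).1]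
        have e1 := rpow_le_two_rpow_mul (β := α - 1) (M := α + 1) hx (hδt t ht).1 (hδt t ht).2
          (abs_le.2 ⟨by linarith, by linarith⟩)
        have e2 := rpow_le_two_rpow_mul (β := α) (M := α + 1) hx (hδt t ht).1 (hδt t ht).2
          (abs_le.2 ⟨by linarith, by linarith⟩)
        have hκ1 : 1 ≤ κ⁻¹ := (one_le_inv₀ hκ).2 (by linarith)
        refine add_le_add ?_ ?_
        · rw [← ofReal_norm, ← ENNReal.ofReal_mul (by positivity),
            ← ENNReal.ofReal_mul hK0, hdl, Real.norm_eq_abs]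
          apply ENNReal.ofReal_le_ofReal
          calc κ⁻¹ * d ^ (α - 1) * |u (x + t • e)|
              ≤ κ⁻¹ * (2 ^ (α + 1) * δ (x + t • e) ^ (α - 1)) * |u (x + t • e)| := by gcongr
            _ = _ := by rw [hK]; ring
        · rw [← ofReal_norm, ← ENNReal.ofReal_mul (by positivity),
            ← ENNReal.ofReal_mul hK0]
          apply ENNReal.ofReal_le_ofReal
          calc d ^ α * ‖deriv (fun t : ℝ => u (x + t • e)) t‖
              ≤ (1 * 2 ^ (α + 1) * δ (x + t • e) ^ α) * ‖fderiv ℝ u (x + t • e)‖ := by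
                rw [one_mul]; gcongr; exact hbound t ht
            _ ≤ (κ⁻¹ * 2 ^ (α + 1) * δ (x + t • e) ^ α) * ‖fderiv ℝ u (x + t • e)‖ := by
                gcongr
            _ = _ := by rw [hK]; ring
    _ ≤ ∫⁻ t : ℝ, ENNReal.ofReal K *
          G.indicator (fun y => ENNReal.ofReal (|u y| * δ y ^ (α - 1)) +
        ENNReal.ofReal (‖fderiv ℝ u y‖ * δ y ^ α)) (x + t • e) := setLIntegral_le_lintegral _ _
    _ = _ := lintegral_const_mul' _ _ ENNReal.ofReal_ne_top

/-- The Gagliardo–Nirenberg inequality for a function dominated by the integrals of `F` along all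
coordinate lines. -/
theorem lintegral_rpow_le_of_le_lintegral_line {n : ℕ} (hn : 2 ≤ n)
    {F h : EuclideanSpace ℝ (Fin n) → ℝ≥0∞} (hF : Measurable F)
    (hh : ∀ x i, h x ≤ ∫⁻ t : ℝ, F (x + t • EuclideanSpace.single i 1)) :
    ∫⁻ x, h x ^ ((n : ℝ) / (n - 1)) ≤ (∫⁻ x, F x) ^ ((n : ℝ) / (n - 1)) := by
  have hn' : (2 : ℝ) ≤ n := by exact_mod_cast hn
  have hconj : Real.HolderConjugate (Fintype.card (Fin n) : ℝ) ((n : ℝ) / (n - 1)) := by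
    rw [Fintype.card_fin]
    exact Real.HolderConjugate.conjExponent (by linarith)
  have hmp := PiLp.volume_preserving_toLp (Fin n)
  have hemb := (MeasurableEquiv.toLp 2 (Fin n → ℝ)).measurableEmbedding
  have hFm : Measurable fun y : Fin n → ℝ => F (WithLp.toLp 2 y) := hF.comp hmp.measurable
  have main := lintegral_prod_lintegral_pow_le (fun _ : Fin n => (volume : Measure ℝ)) hconj hFm
  rw [← volume_pi] at main
  have eF : ∫⁻ x, F x = ∫⁻ y : Fin n → ℝ, F (WithLp.toLp 2 y) :=
    (hmp.lintegral_comp_emb hemb F).symm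
  have eh : ∫⁻ x, h x ^ ((n : ℝ) / (n - 1)) =
      ∫⁻ y : Fin n → ℝ, h (WithLp.toLp 2 y) ^ ((n : ℝ) / (n - 1)) :=
    (hmp.lintegral_comp_emb hemb fun x => h x ^ ((n : ℝ) / (n - 1))).symm
  rw [eF, eh]
  refine le_trans (lintegral_mono fun y => ?_) main
  have hline : ∀ i, h (WithLp.toLp 2 y) ≤
      ∫⁻ t : ℝ, F (WithLp.toLp 2 (Function.update y i t)) := fun i => by
    refine (hh _ i).trans_eq ?_
    rw [← lintegral_add_left_eq_self (μ := volume)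
      (fun t : ℝ => F (WithLp.toLp 2 (Function.update y i t))) (y i)]
    refine lintegral_congr fun t => congrArg F ?_
    ext j
    by_cases hj : j = i
    · subst hj; simp
    · simp [hj]
  calc h (WithLp.toLp 2 y) ^ ((n : ℝ) / (n - 1))
      = ∏ _i : Fin n, h (WithLp.toLp 2 y) ^ ((1 : ℝ) / (Fintype.card (Fin n) - 1 : ℝ)) := by
        rw [Finset.prod_const, Finset.card_univ, Fintype.card_fin, ← ENNReal.rpow_natCast,
          ← ENNReal.rpow_mul]
        congr 1; ring
    _ ≤ _ := by
        refine Finset.prod_le_prod' fun i _ => ?_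
        refine ENNReal.rpow_le_rpow (hline i) ?_
        rw [Fintype.card_fin]
        have : (0 : ℝ) < n - 1 := by linarith
        positivity

section OrientedDistance

variable {E : Type*} [NormedAddCommGroup E] {D : Set E} {dD : E → ℝ}

theorem orientedDist_eq_neg_of_mem (hdD : ∀ x, dD x = Metric.infDist x D - Metric.infDist x Dᶜ)
    {x : E} (hx : x ∈ D) : dD x = -Metric.infDist x Dᶜ := by
  rw [hdD, Metric.infDist_zero_of_mem hx, zero_sub]

theorem orientedDist_eq_of_notMem (hdD : ∀ x, dD x = Metric.infDist x D - Metric.infDist x Dᶜ)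
    {x : E} (hx : x ∉ D) : dD x = Metric.infDist x D := by
  rw [hdD, Metric.infDist_zero_of_mem (show x ∈ Dᶜ from hx), sub_zero]

theorem lipschitzWith_orientedDist_s3
    (hdD : ∀ x, dD x = Metric.infDist x D - Metric.infDist x Dᶜ) : LipschitzWith 2 dD := by
  rw [show dD = fun x => Metric.infDist x D - Metric.infDist x Dᶜ from funext hdD]
  have := (Metric.lipschitz_infDist_pt D).sub (Metric.lipschitz_infDist_pt Dᶜ)
  rwa [one_add_one_eq_two] at this

theorem exists_norm_le_of_orientedDist_lt (hD_bdd : Bornology.IsBounded D) (hD_ne : D.Nonempty)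
    (hdD : ∀ x, dD x = Metric.infDist x D - Metric.infDist x Dᶜ) (ε : ℝ) :
    ∃ R, ∀ x, dD x < ε → ‖x‖ ≤ R := by
  obtain ⟨R, hR⟩ := hD_bdd.subset_closedBall (0 : E)
  refine ⟨max R (R + ε), fun x hx => ?_⟩
  by_cases hxD : x ∈ D
  · exact le_max_of_le_left (mem_closedBall_zero_iff.1 (hR hxD))
  · rw [orientedDist_eq_of_notMem hdD hxD] at hx
    obtain ⟨p, hp, hxp⟩ := (Metric.infDist_lt_iff hD_ne).1 hx
    have hpR := mem_closedBall_zero_iff.1 (hR hp)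
    rw [dist_eq_norm] at hxp
    have := norm_le_norm_add_norm_sub' x p
    exact le_max_of_le_right (by linarith)

variable [NormedSpace ℝ E] [FiniteDimensional ℝ E]

/-- If the oriented distance function is `C^{1,1}` near the boundary, then near every boundary
point it attains the value `ε` within distance comparable to `ε`. -/
theorem exists_orientedDist_ge_near_frontier
    (hD_open : IsOpen D) (hD_bdd : Bornology.IsBounded D) (hDc : Dᶜ.Nonempty)
    (hdD : ∀ x, dD x = Metric.infDist x D - Metric.infDist x Dᶜ)
    (hC11 : ∃ U : Set E, IsOpen U ∧ frontier D ⊆ U ∧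
      ContDiffOn ℝ 1 dD U ∧ ∃ L : NNReal, LipschitzOnWith L (fun x => fderiv ℝ dD x) U) :
    ∃ ε₁ > 0, ∀ ε ∈ Ioc 0 ε₁, ∀ y ∈ frontier D, ∃ z, dist y z ≤ 3 * ε ∧ ε ≤ dD z := by
  obtain ⟨U, hU, hDU, hsmooth, L, hL⟩ := hC11
  have hcomp : IsCompact (frontier D) :=
    Metric.isCompact_of_isClosed_isBounded isClosed_frontier
      (hD_bdd.closure.subset frontier_subset_closure)
  obtain ⟨r, hr, hrU⟩ := hcomp.exists_thickening_subset_open hU hDU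
  refine ⟨min (r / 4) (1 / (24 * (L + 1))), by positivity, fun ε hε y hy => ?_⟩
  have hε0 : 0 < ε := hε.1
  have hεr : 4 * ε ≤ r := by linarith [hε.2.trans (min_le_left _ _)]
  have hεL : (L : ℝ) * ε ≤ 1 / 24 := by
    have h := hε.2.trans (min_le_right _ _)
    rw [le_div_iff₀ (by positivity)] at h
    nlinarith [L.coe_nonneg]
  obtain ⟨x, hxD, hyx⟩ := Metric.mem_closure_iff.1 (frontier_subset_closure hy) (ε / 4)
    (by positivity)
  obtain ⟨p, hp, hxp⟩ := exists_mem_frontier_infDist_compl_eq_dist hxD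
    (fun h => by simp [h] at hDc)
  have hyD : y ∉ D := fun h => hD_open.inter_frontier_eq.subset ⟨h, hy⟩
  have hpD : p ∉ D := fun h => hD_open.inter_frontier_eq.subset ⟨h, hp⟩
  have hdx : dD x = -dist x p := by rw [orientedDist_eq_neg_of_mem hdD hxD, hxp]
  have hdp : dD p = 0 := by
    rw [orientedDist_eq_of_notMem hdD hpD]
    exact Metric.infDist_zero_of_mem_closure (frontier_subset_closure hp)
  set d := dist x p with hd
  have hd0 : 0 < d := dist_pos.2 fun h => hpD (h ▸ hxD)
  have hdε : d < ε / 4 := by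
    rw [← hxp]
    refine (Metric.infDist_le_dist_of_mem (show y ∈ Dᶜ from hyD)).trans_lt ?_
    rwa [dist_comm]
  have hball : Metric.ball x (3 * ε) ⊆ U := fun w hw => by
    refine hrU (Metric.mem_thickening_iff.2 ⟨y, hy, ?_⟩)
    have := dist_triangle w x y
    rw [Metric.mem_ball] at hw
    rw [dist_comm] at hyx
    linarith
  have hxball : x ∈ Metric.ball x (3 * ε) := Metric.mem_ball_self (by positivity)
  have hdiff : ∀ w ∈ Metric.ball x (3 * ε), DifferentiableAt ℝ dD w := fun w hw =>
    (hsmooth.differentiableOn (by norm_num)).differentiableAt (hU.mem_nhds (hball hw))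
  have hbound : ∀ w ∈ Metric.ball x (3 * ε), ‖fderiv ℝ dD w - fderiv ℝ dD x‖ ≤ 1 / 8 := by
    intro w hw
    have h := hL.dist_le_mul w (hball hw) x (hball hxball)
    rw [dist_eq_norm] at h
    have h' : dist w x ≤ 3 * ε := (Metric.mem_ball.1 hw).le
    nlinarith [L.coe_nonneg, mul_le_mul_of_nonneg_left h' L.coe_nonneg]
  have htaylor := fun (w : E) (hw : w ∈ Metric.ball x (3 * ε)) =>
    (convex_ball x (3 * ε)).norm_image_sub_le_of_norm_fderiv_le' hdiff hbound hxball hw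
  have hpball : p ∈ Metric.ball x (3 * ε) := by
    rw [Metric.mem_ball, dist_comm]; linarith
  have hnorm : ‖p - x‖ = d := by rw [hd, dist_comm, dist_eq_norm]
  have h1 := htaylor p hpball
  rw [hdp, hdx, hnorm, Real.norm_eq_abs] at h1
  have h1' := (abs_le.1 h1).2
  set z := x + (2 * ε / d) • (p - x) with hz
  have hzx : z - x = (2 * ε / d) • (p - x) := by rw [hz, add_sub_cancel_left]
  have hznorm : ‖z - x‖ = 2 * ε := by
    rw [hzx, norm_smul, hnorm, Real.norm_eq_abs, abs_of_pos (by positivity)]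
    field_simp
  have hzball : z ∈ Metric.ball x (3 * ε) := by
    rw [Metric.mem_ball, dist_eq_norm, hznorm]; linarith
  have h2 := htaylor z hzball
  rw [hznorm, Real.norm_eq_abs, hdx, hzx, map_smul, smul_eq_mul] at h2
  have h2' := (abs_le.1 h2).1
  have h3 : 2 * ε / d * (7 / 8 * d) ≤ 2 * ε / d * fderiv ℝ dD x (p - x) := by
    gcongr; linarith
  have h4 : 2 * ε / d * (7 / 8 * d) = 7 / 4 * ε := by field_simp; norm_num
  refine ⟨z, ?_, by linarith⟩
  have := dist_triangle y x z
  rw [dist_comm x z, dist_eq_norm z x, hznorm] at this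
  linarith

/-- The exterior part of the `ε`-neighbourhood of `D` has width comparable to `ε`. -/
theorem exists_infDist_frontier_le_mul [Nontrivial E]
    (hD_open : IsOpen D) (hD_bdd : Bornology.IsBounded D) (hD_ne : D.Nonempty)
    (hdD : ∀ x, dD x = Metric.infDist x D - Metric.infDist x Dᶜ)
    (hC11 : ∃ U : Set E, IsOpen U ∧ frontier D ⊆ U ∧
      ContDiffOn ℝ 1 dD U ∧ ∃ L : NNReal, LipschitzOnWith L (fun x => fderiv ℝ dD x) U)
    (ε₀ : ℝ) :
    ∃ C : ℝ, 1 ≤ C ∧ ∀ ε ∈ Ioo 0 ε₀, ∀ x, dD x < ε → x ∉ D →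
      Metric.infDist x (frontier {x | dD x < ε}) ≤ C * ε := by
  have hDu : D ≠ univ := fun h =>
    NormedSpace.unbounded_univ ℝ E (h ▸ hD_bdd)
  have hDc : Dᶜ.Nonempty := nonempty_compl.2 hDu
  obtain ⟨ε₁, hε₁, hnear⟩ := exists_orientedDist_ge_near_frontier hD_open hD_bdd hDc hdD hC11
  obtain ⟨R, hR⟩ := exists_norm_le_of_orientedDist_lt hD_bdd hD_ne hdD ε₀
  obtain ⟨w, hw⟩ := NormedSpace.exists_lt_norm ℝ E R
  refine ⟨max 4 ((R + ‖w‖) / ε₁), le_max_of_le_left (by norm_num), fun ε hε x hx hxD => ?_⟩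
  have hε0 : 0 < ε := hε.1
  have hx' : x ∈ {x | dD x < ε} := hx
  rw [orientedDist_eq_of_notMem hdD hxD] at hx
  rcases le_or_gt ε ε₁ with h | h
  · obtain ⟨y, hy, hxy⟩ := exists_mem_frontier_infDist_compl_eq_dist
      (show x ∈ Dᶜ from hxD) (fun h => by simp [compl_univ_iff.1 h] at hD_ne)
    rw [compl_compl] at hxy
    rw [frontier_compl] at hy
    obtain ⟨z, hz, hdz⟩ := hnear ε ⟨hε0, h⟩ y hy
    calc Metric.infDist x (frontier {x | dD x < ε}) ≤ dist x z :=
          infDist_frontier_le_dist hx' (by simpa using hdz)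
      _ ≤ dist x y + dist y z := dist_triangle _ _ _
      _ ≤ 4 * ε := by linarith
      _ ≤ _ := by gcongr; exact le_max_left _ _
  · have hwε : w ∉ {x | dD x < ε} := fun h => hw.not_ge (hR w (lt_trans h hε.2))
    calc Metric.infDist x (frontier {x | dD x < ε}) ≤ dist x w :=
          infDist_frontier_le_dist hx' hwε
      _ ≤ ‖x‖ + ‖w‖ := dist_le_norm_add_norm _ _
      _ ≤ R + ‖w‖ := by gcongr; exact hR x (hx'.trans hε.2)
      _ = (R + ‖w‖) / ε₁ * ε₁ := by field_simp
      _ ≤ max 4 ((R + ‖w‖) / ε₁) * ε := by gcongr; exact le_max_right _ _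

end OrientedDistance

theorem rpow_mul_rpow_le_interpolate {N α q a d M : ℝ} (hN : 1 < N) (hq : 1 ≤ q)
    (hqN : (N + α - 1) * q ≤ N + α) (ha : 0 ≤ a) (hd : 0 < d) (hdM : d ≤ M) :
    a ^ q * d ^ α ≤ M ^ (N + α - (N + α - 1) * q) *
      ((a * d ^ (α - 1)) ^ (N - (N - 1) * q) *
        ((a * d ^ α) ^ (N / (N - 1))) ^ ((N - 1) * (q - 1))) := by
  rcases ha.eq_or_lt with rfl | ha
  · rw [Real.zero_rpow (by linarith), zero_mul]
    have := hd.le.trans hdM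
    positivity
  have hN1 : N - 1 ≠ 0 := by linarith
  have key : a ^ q * d ^ α = d ^ (N + α - (N + α - 1) * q) *
      ((a * d ^ (α - 1)) ^ (N - (N - 1) * q) *
        ((a * d ^ α) ^ (N / (N - 1))) ^ ((N - 1) * (q - 1))) := by
    rw [← Real.rpow_mul (by positivity), Real.mul_rpow ha.le (by positivity),
      Real.mul_rpow ha.le (by positivity), ← Real.rpow_mul hd.le, ← Real.rpow_mul hd.le,
      show N / (N - 1) * ((N - 1) * (q - 1)) = N * (q - 1) by field_simp]
    have hA : a ^ q = a ^ (N - (N - 1) * q) * a ^ (N * (q - 1)) := by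
      rw [← Real.rpow_add ha]; congr 1; ring
    have hB : d ^ α = d ^ (N + α - (N + α - 1) * q) * d ^ ((α - 1) * (N - (N - 1) * q)) *
        d ^ (α * (N * (q - 1))) := by
      rw [← Real.rpow_add hd, ← Real.rpow_add hd]; congr 1; ring
    rw [hA, hB]
    ring
  rw [key]
  gcongr

/-- Sobolev-type estimate near the boundary for power weights
`δ^α`, `δ(x) = dist(x, ∂D_ε)`, with constant independent of `ε`. -/
theorem sobolev_boundary_power_weight
    (n : ℕ) (hn : 2 ≤ n)
    (D : Set (EuclideanSpace ℝ (Fin n)))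
    (hD_open : IsOpen D) (hD_bdd : Bornology.IsBounded D) (hD_ne : D.Nonempty)
    (dD : EuclideanSpace ℝ (Fin n) → ℝ)
    (hdD : ∀ x, dD x = Metric.infDist x D - Metric.infDist x Dᶜ)
    (Dt : ℝ → Set (EuclideanSpace ℝ (Fin n)))
    (hDt : ∀ t, Dt t = {x | dD x < t})
    (Γ : ℝ → Set (EuclideanSpace ℝ (Fin n)))
    (hΓ : ∀ ε : ℝ, Γ ε = Dt ε \ closure (Dt (-ε)))
    (ε₀ : ℝ) (hε₀ : 0 < ε₀)
    (hproj : ∀ z ∈ Γ (2 * ε₀), ∃! y, y ∈ frontier D ∧ dist z y = Metric.infDist z (frontier D))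
    (hC11 : ∃ U : Set (EuclideanSpace ℝ (Fin n)), IsOpen U ∧ frontier D ⊆ U ∧
      ContDiffOn ℝ 1 dD U ∧ ∃ L : NNReal, LipschitzOnWith L (fun x => fderiv ℝ dD x) U)
    (hε₀_le : ε₀ ≤ 1)
    (α : ℝ) (hα : 0 < α) :
    ∀ q : ℝ, 1 ≤ q → ((n : ℝ) + α - 1) * q ≤ (n : ℝ) + α →
      ∃ C : ℝ, 0 < C ∧ ∀ ε ∈ Set.Ioo (0:ℝ) ε₀,
        ∀ u : EuclideanSpace ℝ (Fin n) → ℝ, Measurable u →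
          (∀ x ∈ Dt ε, DifferentiableAt ℝ u x) →
          (∫⁻ x in Dt ε \ D,
              ENNReal.ofReal (|u x| ^ q * Metric.infDist x (frontier (Dt ε)) ^ α)) ^ (1 / q) ≤
            ENNReal.ofReal C *
              ((∫⁻ x in Γ ε,
                  ENNReal.ofReal (|u x| * Metric.infDist x (frontier (Dt ε)) ^ (α - 1))) +
               ∫⁻ x in Γ ε,
                  ENNReal.ofReal (‖fderiv ℝ u x‖ * Metric.infDist x (frontier (Dt ε)) ^ α)) := by
  intro q hq hqn
  have hn' : (2 : ℝ) ≤ n := by exact_mod_cast hn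
  have : Nonempty (Fin n) := ⟨⟨0, by omega⟩⟩
  obtain ⟨C₁, hC₁, hwidth⟩ := exists_infDist_frontier_le_mul hD_open hD_bdd hD_ne hdD hC11 ε₀
  obtain ⟨R, hR⟩ := exists_norm_le_of_orientedDist_lt hD_bdd hD_ne hdD ε₀
  obtain ⟨w, hw⟩ := NormedSpace.exists_lt_norm ℝ (EuclideanSpace ℝ (Fin n)) R
  have hdDc : Continuous dD := (lipschitzWith_orientedDist_s3 hdD).continuous
  set κ := 1 / (4 * C₁) with hκ
  have hκ0 : 0 < κ := by positivity
  have hκ2 : κ ≤ 1 / 2 := by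
    rw [hκ]; gcongr; linarith
  set K := κ⁻¹ * (2 : ℝ) ^ (α + 1) with hK
  have hK0 : 0 < K := by positivity
  set M := (C₁ * ε₀) ^ (n + α - (n + α - 1) * q) with hM
  have hM0 : 0 < M := by positivity
  refine ⟨(M * K ^ (n * (q - 1))) ^ (1 / q), by positivity, fun ε hε u hu hdiff => ?_⟩
  have hDtε : Dt ε = {x | dD x < ε} := hDt ε
  have hDopen : IsOpen (Dt ε) := hDtε ▸ isOpen_lt hdDc continuous_const
  have hΓmem : ∀ x, -ε < dD x → x ∈ Dt ε → x ∈ Γ ε := fun x hx hxε => by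
    rw [hΓ]
    refine ⟨hxε, fun hcl => hx.not_ge ?_⟩
    rw [hDt] at hcl
    exact closure_lt_subset_le hdDc continuous_const hcl
  have hXΓ : Dt ε \ D ⊆ Γ ε := fun x hx => hΓmem x (by
    rw [orientedDist_eq_of_notMem hdD hx.2]
    linarith [Metric.infDist_nonneg (x := x) (s := D), hε.1]) hx.1
  have hΓmeas : MeasurableSet (Γ ε) := by
    rw [hΓ]; exact hDopen.measurableSet.diff isClosed_closure.measurableSet
  have hXmeas : MeasurableSet (Dt ε \ D) := hDopen.measurableSet.diff hD_open.measurableSet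
  have hne : Dt ε ≠ univ := fun h => hw.not_ge (hR w (by
    have : w ∈ Dt ε := h ▸ mem_univ w
    rw [hDtε] at this
    exact lt_trans this hε.2))
  set δ := fun x => Metric.infDist x (frontier (Dt ε)) with hδ
  have hδlip : LipschitzWith 1 δ := Metric.lipschitz_infDist_pt _
  have hδmeas : Measurable δ := hδlip.continuous.measurable
  have hδpos : ∀ x ∈ Dt ε, 0 < δ x := fun x hx => by
    obtain ⟨y, hy, -⟩ := exists_mem_frontier_infDist_compl_eq_dist hx hne
    refine (isClosed_frontier.notMem_iff_infDist_pos ⟨y, hy⟩).1 fun h => ?_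
    exact hDopen.inter_frontier_eq.subset ⟨hx, h⟩
  have hδle : ∀ x ∈ Dt ε \ D, δ x ≤ C₁ * ε := fun x hx => by
    simp only [hδ, hDtε]
    exact hwidth ε hε x (by simpa [hDtε] using hx.1) hx.2
  set F : EuclideanSpace ℝ (Fin n) → ℝ≥0∞ := (Γ ε).indicator fun y =>
    ENNReal.ofReal (|u y| * δ y ^ (α - 1)) + ENNReal.ofReal (‖fderiv ℝ u y‖ * δ y ^ α) with hF
  have hm1 : Measurable fun y => ENNReal.ofReal (|u y| * δ y ^ (α - 1)) :=
    ((by fun_prop : Measurable fun y => |u y|).mul (hδmeas.pow_const _)).ennreal_ofReal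
  have hm2 : Measurable fun y => ENNReal.ofReal (‖fderiv ℝ u y‖ * δ y ^ α) :=
    ((measurable_fderiv ℝ u).norm.mul (hδmeas.pow_const _)).ennreal_ofReal
  have hFmeas : Measurable F := (hm1.add hm2).indicator hΓmeas
  have hFint : ∫⁻ x, F x = (∫⁻ x in Γ ε, ENNReal.ofReal (|u x| * δ x ^ (α - 1))) +
      ∫⁻ x in Γ ε, ENNReal.ofReal (‖fderiv ℝ u x‖ * δ x ^ α) := by
    rw [hF, lintegral_indicator hΓmeas, lintegral_add_left hm1]
  change (∫⁻ x in Dt ε \ D, ENNReal.ofReal (|u x| ^ q * δ x ^ α)) ^ (1 / q) ≤ _ *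
    ((∫⁻ x in Γ ε, ENNReal.ofReal (|u x| * δ x ^ (α - 1))) +
      ∫⁻ x in Γ ε, ENNReal.ofReal (‖fderiv ℝ u x‖ * δ x ^ α))
  have hA : ∫⁻ x in Dt ε \ D, ENNReal.ofReal (|u x| * δ x ^ (α - 1)) ≤ ∫⁻ x, F x := by
    rw [hFint]
    exact (lintegral_mono_set hXΓ).trans le_self_add
  have hline : ∀ x i, (Dt ε \ D).indicator (fun x => ENNReal.ofReal (|u x| * δ x ^ α)) x ≤
      ∫⁻ t : ℝ, ENNReal.ofReal K * F (x + t • EuclideanSpace.single i 1) := fun x i => by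
    by_cases hx : x ∈ Dt ε \ D
    swap
    · simp [hx]
    rw [indicator_of_mem hx, lintegral_const_mul' _ _ ENNReal.ofReal_ne_top,
      ENNReal.ofReal_mul (abs_nonneg _), ← Real.norm_eq_abs, ofReal_norm]
    refine enorm_mul_rpow_le_lintegral_line hδlip (by simp) hα hκ0 hκ2 (hδpos x hx.1)
      fun t ht => ?_
    have hd := hδpos x hx.1
    have hdist : dist x (x + t • EuclideanSpace.single i (1 : ℝ)) = t := by
      simp [norm_smul, abs_of_nonneg ht.1]
    have hmem : x + t • EuclideanSpace.single i (1 : ℝ) ∈ Dt ε := by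
      by_contra hnot
      have h := infDist_frontier_le_dist hx.1 hnot
      rw [hdist] at h
      have : t ≤ 1 / 2 * δ x := ht.2.trans (by gcongr)
      simp only [hδ] at this hd
      linarith
    refine ⟨hΓmem _ ?_ hmem, hdiff _ hmem⟩
    have hlip := (lipschitzWith_orientedDist_s3 hdD).dist_le_mul x
      (x + t • EuclideanSpace.single i (1 : ℝ))
    rw [hdist, Real.dist_eq] at hlip
    have h1 := (abs_le.1 hlip).2
    have h2 : t ≤ ε / 4 := calc
      t ≤ κ * δ x := ht.2
      _ ≤ κ * (C₁ * ε) := by gcongr; exact hδle x hx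
      _ = ε / 4 := by rw [hκ]; field_simp
    have h3 : 0 ≤ dD x := by
      rw [orientedDist_eq_of_notMem hdD hx.2]; exact Metric.infDist_nonneg
    norm_num at h1
    linarith [hε.1]
  have hB : ∫⁻ x in Dt ε \ D, ENNReal.ofReal (|u x| * δ x ^ α) ^ ((n : ℝ) / (n - 1)) ≤
      (ENNReal.ofReal K * ∫⁻ x, F x) ^ ((n : ℝ) / (n - 1)) := by
    have h := lintegral_rpow_le_of_le_lintegral_line hn (hFmeas.const_mul (ENNReal.ofReal K)) hline
    rw [lintegral_const_mul _ hFmeas] at h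
    refine le_trans ?_ h
    rw [← lintegral_indicator hXmeas]
    refine lintegral_mono fun x => ?_
    by_cases hx : x ∈ Dt ε \ D <;> simp [hx]
  rw [← hFint]
  set I := ∫⁻ x, F x with hI
  have hθ : 0 ≤ (n : ℝ) - (n - 1) * q := by nlinarith
  have hθ' : 0 ≤ ((n : ℝ) - 1) * (q - 1) := mul_nonneg (by linarith) (by linarith)
  have hn1 : (n : ℝ) - 1 ≠ 0 := by linarith
  have hnq : 0 ≤ (n : ℝ) * (q - 1) := mul_nonneg (by linarith) (by linarith)
  have hmain : ∫⁻ x in Dt ε \ D, ENNReal.ofReal (|u x| ^ q * δ x ^ α) ≤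
      ENNReal.ofReal (M * K ^ (n * (q - 1))) * I ^ q := calc
    _ ≤ ∫⁻ x in Dt ε \ D, ENNReal.ofReal M *
        (ENNReal.ofReal (|u x| * δ x ^ (α - 1)) ^ ((n : ℝ) - (n - 1) * q) *
        (ENNReal.ofReal (|u x| * δ x ^ α) ^ ((n : ℝ) / (n - 1))) ^
          (((n : ℝ) - 1) * (q - 1))) := by
      refine setLIntegral_mono' hXmeas fun x hx => ?_
      have hd := hδpos x hx.1
      have hn0 : 0 ≤ (n : ℝ) / (n - 1) := div_nonneg (by linarith) (by linarith)
      rw [ENNReal.ofReal_rpow_of_nonneg (by positivity) hθ,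
        ENNReal.ofReal_rpow_of_nonneg (by positivity) hn0,
        ENNReal.ofReal_rpow_of_nonneg (by positivity) hθ',
        ← ENNReal.ofReal_mul (by positivity), ← ENNReal.ofReal_mul hM0.le]
      refine ENNReal.ofReal_le_ofReal (rpow_mul_rpow_le_interpolate (by linarith) hq hqn
        (abs_nonneg _) hd ((hδle x hx).trans ?_))
      gcongr
      exact hε.2.le
    _ ≤ ENNReal.ofReal M * (I ^ ((n : ℝ) - (n - 1) * q) *
        ((ENNReal.ofReal K * I) ^ ((n : ℝ) / (n - 1))) ^ (((n : ℝ) - 1) * (q - 1))) := by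
      rw [lintegral_const_mul' _ _ ENNReal.ofReal_ne_top]
      gcongr
      refine (ENNReal.lintegral_mul_norm_pow_le hm1.aemeasurable ?_ hθ hθ' (by ring)).trans ?_
      · exact (((by fun_prop : Measurable fun y => |u y|).mul
          (hδmeas.pow_const _)).ennreal_ofReal.pow_const _).aemeasurable
      · gcongr
    _ = _ := by
      rw [← ENNReal.rpow_mul, show (n : ℝ) / (n - 1) * ((n - 1) * (q - 1)) = n * (q - 1) by
        field_simp, ENNReal.mul_rpow_of_nonneg _ _ hnq, ENNReal.ofReal_mul hM0.le,
        ENNReal.ofReal_rpow_of_nonneg hK0.le hnq,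
        show I ^ q = I ^ ((n : ℝ) - (n - 1) * q) * I ^ (n * (q - 1)) by
          rw [← ENNReal.rpow_add_of_nonneg _ _ hθ hnq]; congr 1; ring]
      ring
  calc _ ≤ (ENNReal.ofReal (M * K ^ (n * (q - 1))) * I ^ q) ^ (1 / q) := by gcongr
    _ = _ := by
      have hq0 : q ≠ 0 := by linarith
      rw [ENNReal.mul_rpow_of_nonneg _ _ (by positivity), ← ENNReal.rpow_mul,
        mul_one_div_cancel hq0, ENNReal.rpow_one,
        ENNReal.ofReal_rpow_of_nonneg (by positivity) (by positivity)]
end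
end
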